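/- arXiv:1904.09957 — 2 statements merged into one kernel-verified Lean document; each statement's English description precedes it below -/
import Mathlib

section
/- Let Ω be a bounded open subset of ℝ² whose boundary is a finite union of C¹ Jordan curves, let f ∈ L¹(Ω), and let u be the solution of the Dirichlet problem Δu = f in Ω with u = 0 on ∂Ω. Then the gradient ∇u belongs to the weak Lebesgue space L^{2,∞}(Ω) and satisfies ‖∇u‖_{L^{2,∞}(Ω)} ≤ 3·√(2/π)·‖f‖_{L¹(Ω)}, with a constant independent of the domain Ω. -/
open MeasureTheory Complex Metric
open scoped ENNReal NNReal

/-- The weak-`L²` (Lorentz `L^{2,∞}`) quasinorm of `g` on a set `Ω ⊆ ℂ ≅ ℝ²`: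
`sup_{λ>0} λ · (volume {x ∈ Ω : |g x| > λ})^{1/2}`. -/
noncomputable def weakL2On {E : Type*} [NormedAddCommGroup E] (g : ℂ → E) (Ω : Set ℂ) : ℝ≥0∞ :=
  ⨆ (l : ℝ) (_ : 0 < l), ENNReal.ofReal l * (volume {x ∈ Ω | l < ‖g x‖}) ^ (1 / 2 : ℝ)

/-- The Laplacian `Δφ = ∂²φ/∂x₁² + ∂²φ/∂x₂²` of a function on `ℂ ≅ ℝ²`. -/
noncomputable def lap (φ : ℂ → ℝ) (x : ℂ) : ℝ :=
  iteratedFDeriv ℝ 2 φ x ![(1 : ℂ), 1] + iteratedFDeriv ℝ 2 φ x ![Complex.I, Complex.I]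

/-- `γ ⊆ ℂ` is a `C¹` Jordan curve: the image of a regular, injective-on-a-period,
`1`-periodic `C¹` map `ℝ → ℂ`. -/
def IsC1JordanCurve (γ : Set ℂ) : Prop :=
  ∃ f : ℝ → ℂ, ContDiff ℝ 1 f ∧ Function.Periodic f 1 ∧
    Set.InjOn f (Set.Ico (0 : ℝ) 1) ∧ (∀ t, deriv f t ≠ 0) ∧ γ = Set.range f

/-- `Ω` has boundary a finite union of `C¹` Jordan curves. -/
def HasC1JordanBoundary (Ω : Set ℂ) : Prop :=
  ∃ (N : ℕ) (γ : Fin N → Set ℂ), (∀ i, IsC1JordanCurve (γ i)) ∧ frontier Ω = ⋃ i, γ i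

lemma lap_eq (φ : ℂ → ℝ) (x : ℂ) :
    lap φ x = fderiv ℝ (fderiv ℝ φ) x 1 1 + fderiv ℝ (fderiv ℝ φ) x I I := by
  simp [lap, iteratedFDeriv_two_apply]

lemma fderiv_fderiv_apply {φ : ℂ → ℝ} (hφ : ContDiff ℝ 2 φ) (x e e' : ℂ) :
    fderiv ℝ (fun y => fderiv ℝ φ y e) x e' = fderiv ℝ (fderiv ℝ φ) x e' e := by
  have h : DifferentiableAt ℝ (fderiv ℝ φ) x :=
    ((hφ.fderiv_right (m := 1) (by norm_num)).differentiable (by norm_num)) x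
  rw [fderiv_clm_apply h (differentiableAt_const e)]
  simp

lemma contDiff_fderiv_apply_const {φ : ℂ → ℝ} (hφ : ContDiff ℝ 2 φ) (e : ℂ) :
    ContDiff ℝ 1 (fun y => fderiv ℝ φ y e) :=
  (hφ.fderiv_right (m := 1) (by norm_num)).clm_apply contDiff_const

lemma continuous_lap {φ : ℂ → ℝ} (hφ : ContDiff ℝ 2 φ) : Continuous (lap φ) := by
  have h : Continuous (fderiv ℝ (fderiv ℝ φ)) :=
    (hφ.fderiv_right (m := 1) (by norm_num)).continuous_fderiv (by norm_num)
  rw [show lap φ = _ from funext (lap_eq φ)]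
  fun_prop

/-- Polar coordinates centred at `x`. -/
noncomputable def polarAt (x : ℂ) (p : ℝ × ℝ) : ℂ := x + p.1 * exp (p.2 * I)

lemma hasFDerivAt_polarAt (x : ℂ) (p : ℝ × ℝ) :
    ∃ P' : ℝ × ℝ →L[ℝ] ℂ, HasFDerivAt (polarAt x) P' p ∧ P' (1, 0) = exp (p.2 * I) ∧
      P' (0, 1) = p.1 * (exp (p.2 * I) * I) := by
  have h1 : HasFDerivAt (fun p : ℝ × ℝ => (p.1 : ℂ))
      (ofRealCLM.comp (ContinuousLinearMap.fst ℝ ℝ ℝ)) p :=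
    (ofRealCLM.comp (ContinuousLinearMap.fst ℝ ℝ ℝ)).hasFDerivAt
  have h2 : HasFDerivAt (fun p : ℝ × ℝ => (p.2 : ℂ))
      (ofRealCLM.comp (ContinuousLinearMap.snd ℝ ℝ ℝ)) p :=
    (ofRealCLM.comp (ContinuousLinearMap.snd ℝ ℝ ℝ)).hasFDerivAt
  have h3 := (h1.mul (h2.mul_const I).cexp).const_add x
  refine ⟨_, h3, ?_, ?_⟩ <;> simp

lemma continuous_polarAt (x : ℂ) : Continuous (polarAt x) := by
  unfold polarAt; fun_prop

lemma polar_divergence_eq (L : ℂ →L[ℝ] ℂ) (r t : ℝ) (hr : r ≠ 0) :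
    L (exp (t * I)) + I * (r : ℂ)⁻¹ * L (r * (exp (t * I) * I)) =
      exp (-(t * I)) * (L 1 + I * L I) := by
  have hL : ∀ a b : ℝ, L (a + b * I) = a * L 1 + b * L I := by
    intro a b
    rw [map_add]
    congr 1
    · simpa using L.map_smul a (1 : ℂ)
    · simpa using L.map_smul b I
  have e1 : exp (t * I) = (Real.cos t : ℂ) + (Real.sin t : ℂ) * I := by
    rw [exp_mul_I]; simp
  have e2 : exp (-(t * I)) = (Real.cos t : ℂ) - (Real.sin t : ℂ) * I := by
    rw [← neg_mul, exp_mul_I]; simp [sub_eq_add_neg]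
  have e3 : L (r * (exp (t * I) * I)) = r * L (exp (t * I) * I) := by
    simpa using L.map_smul r (exp (t * I) * I)
  have e4 : exp (t * I) * I = ((-Real.sin t : ℝ) : ℂ) + (Real.cos t : ℂ) * I := by
    rw [e1]; push_cast; linear_combination (Complex.sin t) * I_mul_I
  have hr' : (r : ℂ) ≠ 0 := by exact_mod_cast hr
  rw [e3, e4, e1, e2, hL, hL]
  field_simp
  push_cast
  linear_combination ((Complex.sin t) * L I) * I_sq

lemma enorm_circle_integral_le {w : ℂ → ℂ} (hw : ContDiff ℝ 1 w) (hc : HasCompactSupport w)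
    (x : ℂ) {ε : ℝ} (hε : 0 < ε) :
    ‖∫ t in (-Real.pi)..Real.pi, w (polarAt x (ε, t))‖ₑ ≤
      ∫⁻ y, ‖fderiv ℝ w y 1 + I * fderiv ℝ w y I‖ₑ * (‖y - x‖ₑ)⁻¹ := by
  obtain ⟨R, hR, hRw⟩ : ∃ R, ε < R ∧ ∀ t : ℝ, w (polarAt x (R, t)) = 0 := by
    obtain ⟨R₀, hR₀⟩ := hc.isCompact.isBounded.subset_closedBall x
    refine ⟨max R₀ ε + 1, by linarith [le_max_right R₀ ε], fun t => ?_⟩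
    by_contra h
    have := hR₀ (subset_tsupport _ h)
    rw [mem_closedBall, dist_eq_norm] at this
    have h2 : ‖polarAt x (max R₀ ε + 1, t) - x‖ = max R₀ ε + 1 := by
      simp only [polarAt, add_sub_cancel_left, norm_mul, norm_exp_ofReal_mul_I, mul_one]
      rw [norm_real, Real.norm_of_nonneg]
      linarith [le_max_right R₀ ε]
    linarith [le_max_left R₀ ε]
  set k : ℂ → ℂ := fun y => fderiv ℝ w y 1 + I * fderiv ℝ w y I with hk
  have hkc : Continuous k := by
    have := hw.continuous_fderiv (by norm_num)
    fun_prop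
  choose P' hP hP1 hP2 using hasFDerivAt_polarAt x
  have hwd : ∀ p, HasFDerivAt (fun p => w (polarAt x p))
      ((fderiv ℝ w (polarAt x p)).comp (P' p)) p :=
    fun p => ((hw.differentiable (by norm_num)) _).hasFDerivAt.comp p (hP p)
  have hwc : Continuous fun p => w (polarAt x p) := hw.continuous.comp (continuous_polarAt x)
  have hgd : ∀ p : ℝ × ℝ, p.1 ≠ 0 → ∃ g' : ℝ × ℝ →L[ℝ] ℂ,
      HasFDerivAt (fun p : ℝ × ℝ => I * (p.1 : ℂ)⁻¹ * w (polarAt x p)) g' p ∧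
      g' (0, 1) = I * (p.1 : ℂ)⁻¹ * fderiv ℝ w (polarAt x p) (p.1 * (exp (p.2 * I) * I)) := by
    intro p hp
    have h1 : HasFDerivAt (fun p : ℝ × ℝ => (p.1 : ℂ))
        (ofRealCLM.comp (ContinuousLinearMap.fst ℝ ℝ ℝ)) p :=
      (ofRealCLM.comp (ContinuousLinearMap.fst ℝ ℝ ℝ)).hasFDerivAt
    have hp' : (p.1 : ℂ) ≠ 0 := by exact_mod_cast hp
    have h2 := (((hasDerivAt_inv hp').comp_hasFDerivAt_of_eq p h1 rfl).const_mul I).mul (hwd p)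
    refine ⟨_, h2, ?_⟩
    simp [hP2]
  choose! g' hg' hg'1 using hgd
  have key := integral2_divergence_prod_of_hasFDerivAt_off_countable
    (fun p => w (polarAt x p)) (fun p : ℝ × ℝ => I * (p.1 : ℂ)⁻¹ * w (polarAt x p))
    (fun p => (fderiv ℝ w (polarAt x p)).comp (P' p)) g' ε (-Real.pi) R Real.pi ∅
    Set.countable_empty hwc.continuousOn
    (fun p hp => by
      rw [Set.uIcc_of_le hR.le] at hp
      exact (hg' p (hε.trans_le hp.1.1).ne').continuousAt.continuousWithinAt)
    (fun p _ => hwd p)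
    (fun p hp => by
      rw [min_eq_left hR.le] at hp
      exact hg' p (hε.trans hp.1.1.1).ne')
  have hD : ∀ p : ℝ × ℝ, p.1 ≠ 0 →
      ((fderiv ℝ w (polarAt x p)).comp (P' p)) (1, 0) + g' p (0, 1) =
        exp (-(p.2 * I)) * k (polarAt x p) := by
    intro p hp
    rw [hg'1 p hp, ContinuousLinearMap.comp_apply, hP1]
    exact polar_divergence_eq _ _ _ hp
  have hDc : Continuous fun p : ℝ × ℝ => exp (-(p.2 * I)) * k (polarAt x p) := by
    have := hkc.comp (continuous_polarAt x)
    exact Continuous.mul (by fun_prop) this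
  have hDk : ∀ p : ℝ × ℝ, ‖exp (-(p.2 * I)) * k (polarAt x p)‖ₑ = ‖k (polarAt x p)‖ₑ := by
    intro p
    rw [enorm_mul, ← neg_mul, ← ofReal_neg, ← ofReal_norm, norm_exp_ofReal_mul_I]
    simp
  specialize key (by
    refine (hDc.continuousOn.integrableOn_compact
      (isCompact_uIcc.prod isCompact_uIcc)).congr_fun (fun p hp => ?_)
      (measurableSet_uIcc.prod measurableSet_uIcc)
    rw [Set.uIcc_of_le hR.le] at hp
    exact (hD p (hε.trans_le hp.1.1).ne').symm)
  have hper : ∀ r, w (polarAt x (r, Real.pi)) = w (polarAt x (r, -Real.pi)) := by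
    intro r
    simp only [polarAt]
    rw [ofReal_neg, neg_mul, exp_neg, exp_pi_mul_I]
    norm_num
  simp only [hper, hRw, sub_self, intervalIntegral.integral_zero, zero_add, zero_sub] at key
  have hlhs : ‖∫ t in (-Real.pi)..Real.pi, w (polarAt x (ε, t))‖ₑ =
      ‖∫ r in ε..R, ∫ t in (-Real.pi)..Real.pi, exp (-(t * I)) * k (polarAt x (r, t))‖ₑ := by
    rw [← enorm_neg, ← key]
    congr 1
    refine intervalIntegral.integral_congr fun r hr => ?_
    rw [Set.uIcc_of_le hR.le] at hr
    refine intervalIntegral.integral_congr fun t _ => ?_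
    exact hD (r, t) (hε.trans_le hr.1).ne'
  have hpi : -Real.pi ≤ Real.pi := by linarith [Real.pi_pos]
  rw [hlhs]
  calc _ ≤ ∫⁻ r in Set.Ioc ε R, ∫⁻ t in Set.Ioc (-Real.pi) Real.pi, ‖k (polarAt x (r, t))‖ₑ := by
        rw [intervalIntegral.integral_of_le hR.le]
        refine (enorm_integral_le_lintegral_enorm _).trans (lintegral_mono fun r => ?_)
        rw [intervalIntegral.integral_of_le hpi]
        refine (enorm_integral_le_lintegral_enorm _).trans (lintegral_mono fun t => ?_)
        exact (hDk (r, t)).le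
    _ ≤ ∫⁻ r in Set.Ioi (0 : ℝ), ∫⁻ t in Set.Ioc (-Real.pi) Real.pi, ‖k (polarAt x (r, t))‖ₑ :=
        lintegral_mono_set fun r hr => hε.trans hr.1
    _ = ∫⁻ p in Complex.polarCoord.target, ‖k (polarAt x p)‖ₑ := by
        rw [Complex.polarCoord_target, Measure.volume_eq_prod, ← Measure.prod_restrict,
          Measure.restrict_congr_set Ioo_ae_eq_Ioc, lintegral_prod]
        exact (hkc.comp (continuous_polarAt x)).enorm.aemeasurable
    _ = ∫⁻ p in Complex.polarCoord.target, ENNReal.ofReal p.1 •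
          (‖k (x + Complex.polarCoord.symm p)‖ₑ * (‖Complex.polarCoord.symm p‖ₑ)⁻¹) := by
        refine setLIntegral_congr_fun Complex.polarCoord.open_target.measurableSet fun p hp => ?_
        have hp0 : 0 < p.1 := hp.1
        have h1 : polarAt x p = x + Complex.polarCoord.symm p := by
          rw [Complex.polarCoord_symm_apply, polarAt, exp_mul_I]
          simp
        have h2 : ‖Complex.polarCoord.symm p‖ₑ = ENNReal.ofReal p.1 := by
          rw [← ofReal_norm, Complex.norm_polarCoord_symm, abs_of_pos hp0]
        simp only [h1, h2, smul_eq_mul]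
        rw [mul_comm, mul_assoc, ENNReal.inv_mul_cancel (by simpa using hp0) (by simp), mul_one]
    _ = ∫⁻ y, ‖k (x + y)‖ₑ * (‖y‖ₑ)⁻¹ := Complex.lintegral_comp_polarCoord_symm
          (fun y => ‖k (x + y)‖ₑ * (‖y‖ₑ)⁻¹)
    _ = ∫⁻ y, ‖k y‖ₑ * (‖y - x‖ₑ)⁻¹ := by
        rw [← lintegral_add_left_eq_self (fun y => ‖k y‖ₑ * (‖y - x‖ₑ)⁻¹) x]
        simp

lemma enorm_le_lintegral_dbar {w : ℂ → ℂ} (hw : ContDiff ℝ 1 w) (hc : HasCompactSupport w)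
    (x : ℂ) :
    ENNReal.ofReal (2 * Real.pi) * ‖w x‖ₑ ≤
      ∫⁻ y, ‖fderiv ℝ w y 1 + I * fderiv ℝ w y I‖ₑ * (‖y - x‖ₑ)⁻¹ := by
  have hcont : Continuous fun ε : ℝ => ∫ t in (-Real.pi)..Real.pi, w (polarAt x (ε, t)) := by
    apply intervalIntegral.continuous_parametric_intervalIntegral_of_continuous'
    exact hw.continuous.comp (continuous_polarAt x)
  have h0 : ‖∫ t in (-Real.pi)..Real.pi, w (polarAt x (0, t))‖ₑ =
      ENNReal.ofReal (2 * Real.pi) * ‖w x‖ₑ := by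
    simp only [polarAt, ofReal_zero, zero_mul, add_zero, intervalIntegral.integral_const]
    rw [enorm_smul, sub_neg_eq_add, ← two_mul, Real.enorm_of_nonneg (by positivity)]
  rw [← h0]
  refine le_of_tendsto ((hcont.enorm.tendsto 0).mono_left
    (nhdsWithin_le_nhds (s := Set.Ioi 0))) ?_
  filter_upwards [self_mem_nhdsWithin] with ε hε
  exact enorm_circle_integral_le hw hc x hε

/-- Pointwise gradient bound from the representation by the Newtonian potential. -/
lemma enorm_fderiv_le_lintegral_lap {v : ℂ → ℝ} (hv : ContDiff ℝ 2 v) (hc : HasCompactSupport v)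
    (x : ℂ) :
    ENNReal.ofReal (2 * Real.pi) * ‖fderiv ℝ v x‖ₑ ≤ ∫⁻ y, ‖lap v y‖ₑ * (‖y - x‖ₑ)⁻¹ := by
  set w : ℂ → ℂ := fun y => (fderiv ℝ v y 1 : ℂ) - I * (fderiv ℝ v y I : ℂ) with hwdef
  have h1 := contDiff_fderiv_apply_const hv 1
  have h2 := contDiff_fderiv_apply_const hv I
  have hw : ContDiff ℝ 1 w :=
    (ofRealCLM.contDiff.comp h1).sub (contDiff_const.mul (ofRealCLM.contDiff.comp h2))
  have hwc : HasCompactSupport w := by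
    refine (hc.fderiv ℝ).mono fun y hy => ?_
    contrapose! hy
    simp only [Function.mem_support, not_not] at hy ⊢
    simp [hwdef, hy]
  have hw' : ∀ y e, fderiv ℝ w y e =
      (fderiv ℝ (fderiv ℝ v) y e 1 : ℂ) - I * (fderiv ℝ (fderiv ℝ v) y e I : ℂ) := by
    intro y e
    have d1 := ofRealCLM.hasFDerivAt.comp y (h1.differentiable (by norm_num) y).hasFDerivAt
    have d2 := (ofRealCLM.hasFDerivAt.comp y
      (h2.differentiable (by norm_num) y).hasFDerivAt).const_mul I
    have d := (d1.sub d2).fderiv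
    rw [← fderiv_fderiv_apply hv, ← fderiv_fderiv_apply hv]
    have : w = (⇑ofRealCLM ∘ fun y => fderiv ℝ v y 1) -
      fun y => I * (⇑ofRealCLM ∘ fun y => fderiv ℝ v y I) y := rfl
    rw [this, d]
    simp
  have hlap : ∀ y, ‖fderiv ℝ w y 1 + I * fderiv ℝ w y I‖ₑ = ‖lap v y‖ₑ := by
    intro y
    have hsym : fderiv ℝ (fderiv ℝ v) y 1 I = fderiv ℝ (fderiv ℝ v) y I 1 :=
      (hv.contDiffAt.isSymmSndFDerivAt (by simp)).eq _ _
    have : fderiv ℝ w y 1 + I * fderiv ℝ w y I = ((lap v y : ℝ) : ℂ) := by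
      rw [hw', hw', hsym, lap_eq]
      push_cast
      linear_combination (-(fderiv ℝ (fderiv ℝ v) y I I : ℂ)) * I_sq
    rw [this, ← ofReal_norm, ← ofReal_norm, norm_real]
  have hnorm : ‖fderiv ℝ v x‖ ≤ ‖w x‖ := by
    refine ContinuousLinearMap.opNorm_le_bound _ (norm_nonneg _) fun z => ?_
    have e1 : fderiv ℝ v x z = z.re * fderiv ℝ v x 1 + z.im * fderiv ℝ v x I := by
      conv_lhs => rw [← re_add_im z]
      rw [map_add]
      congr 1
      · simpa using (fderiv ℝ v x).map_smul z.re 1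
      · simpa using (fderiv ℝ v x).map_smul z.im I
    have e2 : fderiv ℝ v x z = (w x * z).re := by
      rw [e1]; simp [hwdef]; ring
    rw [e2, ← norm_mul]
    exact abs_re_le_norm _
  have hmain := enorm_le_lintegral_dbar hw hwc x
  simp only [hlap] at hmain
  refine le_trans ?_ hmain
  gcongr
  rw [← ofReal_norm, ← ofReal_norm]
  exact ENNReal.ofReal_le_ofReal hnorm

lemma lintegral_inv_enorm_ball (r : ℝ) (hr : 0 < r) :
    ∫⁻ z : ℂ, (ball (0 : ℂ) r).indicator (fun z => (‖z‖ₑ)⁻¹) z =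
      ENNReal.ofReal (2 * Real.pi * r) := by
  have : ∫⁻ p in Complex.polarCoord.target, ENNReal.ofReal p.1 •
      (ball (0 : ℂ) r).indicator (fun z => (‖z‖ₑ)⁻¹) (Complex.polarCoord.symm p) =
      ∫⁻ p in Complex.polarCoord.target, (Set.Iio r ×ˢ Set.univ).indicator 1 p := by
    refine setLIntegral_congr_fun Complex.polarCoord.open_target.measurableSet fun p hp => ?_
    have hp0 : 0 < p.1 := hp.1
    have h2 : ‖Complex.polarCoord.symm p‖ₑ = ENNReal.ofReal p.1 := by
      rw [← ofReal_norm, Complex.norm_polarCoord_symm, abs_of_pos hp0]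
    have h3 : Complex.polarCoord.symm p ∈ ball (0 : ℂ) r ↔ p.1 < r := by
      rw [mem_ball_zero_iff, Complex.norm_polarCoord_symm, abs_of_pos hp0]
    by_cases h : p.1 < r
    · rw [Set.indicator_of_mem (h3.2 h), Set.indicator_of_mem (by simpa using h), h2, smul_eq_mul,
        ENNReal.mul_inv_cancel (by simpa using hp0) (by simp)]
      rfl
    · rw [Set.indicator_of_notMem (fun h' => h (h3.1 h')),
        Set.indicator_of_notMem (by simpa using h), smul_zero]
  refine (Complex.lintegral_comp_polarCoord_symm _).symm.trans (Eq.trans this ?_)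
  rw [lintegral_indicator_one (measurableSet_Iio.prod .univ),
    Measure.restrict_apply (measurableSet_Iio.prod .univ), Complex.polarCoord_target,
    Set.prod_inter_prod, Set.univ_inter, Set.inter_comm, Set.Ioi_inter_Iio,
    Measure.volume_eq_prod, Measure.prod_prod, Real.volume_Ioo, Real.volume_Ioo,
    ← ENNReal.ofReal_mul (by linarith)]
  congr 1
  ring

lemma setLIntegral_inv_enorm_le (E : Set ℂ) (y : ℂ) {r : ℝ} (hr : 0 < r) :
    ∫⁻ x in E, (‖y - x‖ₑ)⁻¹ ≤
      ENNReal.ofReal (2 * Real.pi * r) + (ENNReal.ofReal r)⁻¹ * volume E := by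
  have hb : ∀ x, (‖y - x‖ₑ)⁻¹ ≤
      (ball (0 : ℂ) r).indicator (fun z => (‖z‖ₑ)⁻¹) (y - x) + (ENNReal.ofReal r)⁻¹ := by
    intro x
    by_cases h : y - x ∈ ball (0 : ℂ) r
    · rw [Set.indicator_of_mem h]; exact le_self_add
    · rw [Set.indicator_of_notMem h, zero_add, ENNReal.inv_le_inv, ← ofReal_norm]
      exact ENNReal.ofReal_le_ofReal (by simpa using h)
  calc _ ≤ ∫⁻ x in E, ((ball (0 : ℂ) r).indicator (fun z => (‖z‖ₑ)⁻¹) (y - x) +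
          (ENNReal.ofReal r)⁻¹) := lintegral_mono hb
    _ = (∫⁻ x in E, (ball (0 : ℂ) r).indicator (fun z => (‖z‖ₑ)⁻¹) (y - x)) +
          (ENNReal.ofReal r)⁻¹ * volume E := by
        rw [lintegral_add_right _ measurable_const, setLIntegral_const]
    _ ≤ (∫⁻ x, (ball (0 : ℂ) r).indicator (fun z => (‖z‖ₑ)⁻¹) (y - x)) +
          (ENNReal.ofReal r)⁻¹ * volume E := by
        gcongr; exact Measure.restrict_le_self
    _ = _ := by
        rw [lintegral_sub_left_eq_self (fun z => (ball (0 : ℂ) r).indicator (fun z => (‖z‖ₑ)⁻¹) z) y,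
          lintegral_inv_enorm_ball r hr]

/-- Weak-type bound for the gradient of a compactly supported function. -/
lemma weak_type_fderiv {v : ℂ → ℝ} (hv : ContDiff ℝ 2 v) (hc : HasCompactSupport v)
    {l : ℝ} (hl : 0 < l) :
    ENNReal.ofReal l * volume {x | l < ‖fderiv ℝ v x‖} ^ (1 / 2 : ℝ) ≤
      ENNReal.ofReal √(2 / Real.pi) * ∫⁻ y, ‖lap v y‖ₑ := by
  set E := {x | l < ‖fderiv ℝ v x‖} with hE
  have hEo : IsOpen E := isOpen_lt continuous_const (hv.continuous_fderiv (by norm_num)).norm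
  have hsupp : volume (tsupport (fderiv ℝ v)) ≠ ⊤ := (hc.fderiv ℝ).isCompact.measure_ne_top
  have hEfin : volume E ≠ ⊤ := by
    refine measure_ne_top_of_subset (fun x hx => subset_tsupport _ fun h => ?_) hsupp
    simp only [hE, Set.mem_ofPred_eq, h, norm_zero] at hx
    linarith
  have hlapc := continuous_lap hv
  have hlapfin : ∫⁻ y, ‖lap v y‖ₑ ≠ ⊤ := by
    have hs : HasCompactSupport (lap v) := by
      refine ((hc.fderiv ℝ).fderiv ℝ).mono fun y hy => ?_
      contrapose! hy
      simp only [Function.mem_support, not_not] at hy ⊢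
      simp [lap_eq, hy]
    exact (hlapc.integrable_of_hasCompactSupport (μ := volume) hs).2.ne
  obtain ⟨M, hM⟩ : ∃ M : ℝ≥0, volume E = M := ⟨_, (ENNReal.coe_toNNReal hEfin).symm⟩
  obtain ⟨A, hA⟩ : ∃ A : ℝ≥0, ∫⁻ y, ‖lap v y‖ₑ = A := ⟨_, (ENNReal.coe_toNNReal hlapfin).symm⟩
  rcases eq_or_lt_of_le (zero_le (a := M)) with h0 | hMpos
  · rw [hM, ← h0]; simp
  have hker : ∀ r : ℝ, 0 < r → ENNReal.ofReal (2 * Real.pi) * (ENNReal.ofReal l * M) ≤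
      A * (ENNReal.ofReal (2 * Real.pi * r) + (ENNReal.ofReal r)⁻¹ * M) := by
    intro r hr
    calc _ = ∫⁻ x in E, ENNReal.ofReal (2 * Real.pi) * ENNReal.ofReal l := by
          rw [setLIntegral_const, hM, mul_assoc]
      _ ≤ ∫⁻ x in E, ∫⁻ y, ‖lap v y‖ₑ * (‖y - x‖ₑ)⁻¹ := by
          refine setLIntegral_mono' hEo.measurableSet fun x hx => ?_
          refine le_trans ?_ (enorm_fderiv_le_lintegral_lap hv hc x)
          gcongr
          rw [← ofReal_norm]
          exact ENNReal.ofReal_le_ofReal (le_of_lt hx)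
      _ = ∫⁻ y, ∫⁻ x in E, ‖lap v y‖ₑ * (‖y - x‖ₑ)⁻¹ := by
          apply lintegral_lintegral_swap
          have := hlapc.measurable
          simp only [Function.uncurry_def]
          fun_prop
      _ = ∫⁻ y, ‖lap v y‖ₑ * ∫⁻ x in E, (‖y - x‖ₑ)⁻¹ := by
          refine lintegral_congr fun y => ?_
          rw [lintegral_const_mul _ (by fun_prop)]
      _ ≤ ∫⁻ y, ‖lap v y‖ₑ * (ENNReal.ofReal (2 * Real.pi * r) + (ENNReal.ofReal r)⁻¹ * M) := by
          gcongr with y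
          rw [← hM]
          exact setLIntegral_inv_enorm_le E y hr
      _ = _ := by rw [lintegral_mul_const _ hlapc.enorm.measurable, hA]
  have hMr : (0 : ℝ) < M := hMpos
  have hpi := Real.pi_pos
  set m := √(M : ℝ) with hm
  have hmpos : 0 < m := Real.sqrt_pos.2 hMr
  have hmm : (M : ℝ) = m ^ 2 := (Real.sq_sqrt hMr.le).symm
  set p := √(2 * Real.pi) with hp
  have hppos : 0 < p := Real.sqrt_pos.2 (by positivity)
  have hpp : 2 * Real.pi = p ^ 2 := (Real.sq_sqrt (by positivity)).symm
  have hr := hker (m / p) (by positivity)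
  have hreal : 2 * Real.pi * (l * M) ≤ A * (2 * Real.pi * (m / p) + (m / p)⁻¹ * M) := by
    rw [← ENNReal.ofReal_le_ofReal_iff (by positivity)]
    convert hr using 1
    · rw [ENNReal.ofReal_mul (by positivity), ENNReal.ofReal_mul hl.le,
        ENNReal.ofReal_coe_nnreal]
    · rw [ENNReal.ofReal_mul (by positivity), ENNReal.ofReal_add (by positivity) (by positivity),
        ENNReal.ofReal_mul (p := (m / p)⁻¹) (by positivity), ENNReal.ofReal_coe_nnreal,
        ENNReal.ofReal_coe_nnreal, ENNReal.ofReal_inv_of_pos (by positivity)]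
  have hfin : l * m ≤ √(2 / Real.pi) * A := by
    have hs : √(2 / Real.pi) = 2 / p := by
      rw [Real.sqrt_eq_iff_eq_sq (by positivity) (by positivity), div_pow, ← hpp]
      field_simp
    rw [hs]
    rw [hpp, hmm] at hreal
    have e : (A : ℝ) * (p ^ 2 * (m / p) + (m / p)⁻¹ * m ^ 2) = (2 / p * A) * (p ^ 2 * m) := by
      field_simp; ring
    rw [e, show p ^ 2 * (l * m ^ 2) = (l * m) * (p ^ 2 * m) by ring] at hreal
    exact le_of_mul_le_mul_right hreal (by positivity)
  rw [hM, hA, ← ENNReal.ofReal_coe_nnreal (p := M), ENNReal.ofReal_rpow_of_pos hMr,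
    ← Real.sqrt_eq_rpow, ← ENNReal.ofReal_mul hl.le, ← ENNReal.ofReal_coe_nnreal (p := A),
    ← ENNReal.ofReal_mul (by positivity)]
  exact ENNReal.ofReal_le_ofReal hfin

lemma integral_fderiv_eq_zero {F : ℂ → ℝ} (hF : ContDiff ℝ 1 F) (hc : HasCompactSupport F) (e : ℂ) :
    Integrable (fun x => fderiv ℝ F x e) ∧ ∫ x, fderiv ℝ F x e = 0 := by
  have hd : Continuous fun x => fderiv ℝ F x e :=
    (hF.continuous_fderiv (by norm_num)).clm_apply continuous_const
  have hi : Integrable (fun x => fderiv ℝ F x e) :=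
    hd.integrable_of_hasCompactSupport (hc.fderiv_apply ℝ e)
  refine ⟨hi, ?_⟩
  have := integral_mul_fderiv_eq_neg_fderiv_mul_of_integrable (𝕜 := ℝ) (μ := (volume : Measure ℂ))
    (f := fun _ : ℂ => (1 : ℝ)) (g := F) (v := e) (by simp) (by simpa using hi)
    (by simpa using hF.continuous.integrable_of_hasCompactSupport hc)
    (fun x _ => differentiableAt_const _) (fun x _ => hF.differentiable (by norm_num) x)
  simpa using this

lemma fderiv_comp_real {Φ : ℝ → ℝ} {U : ℂ → ℝ} (hΦ : Differentiable ℝ Φ)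
    (hU : Differentiable ℝ U) (x e : ℂ) :
    fderiv ℝ (fun y => Φ (U y)) x e = deriv Φ (U x) * fderiv ℝ U x e := by
  have := ((hΦ (U x)).hasDerivAt.comp_hasFDerivAt x (hU x).hasFDerivAt).fderiv
  rw [Function.comp_def] at this
  rw [this]; simp

lemma fderiv_mul_fderiv {q : ℝ → ℝ} {U : ℂ → ℝ} (hq : ContDiff ℝ 1 q)
    (hU : ContDiff ℝ 2 U) (x e : ℂ) :
    fderiv ℝ (fun y => q (U y) * fderiv ℝ U y e) x e =
      q (U x) * fderiv ℝ (fderiv ℝ U) x e e + deriv q (U x) * (fderiv ℝ U x e) ^ 2 := by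
  have hU1 := hU.differentiable (by norm_num)
  have hq1 := hq.differentiable (by norm_num)
  have h1 : DifferentiableAt ℝ (fun y => q (U y)) x := (hq1 (U x)).comp x (hU1 x)
  have h2 := (contDiff_fderiv_apply_const hU e).differentiable (by norm_num) x
  rw [fderiv_fun_mul h1 h2]
  simp only [add_apply, smul_apply, smul_eq_mul]
  rw [fderiv_fderiv_apply hU, fderiv_comp_real hq1 hU1]
  ring

lemma lap_comp {Φ : ℝ → ℝ} {U : ℂ → ℝ} (hΦ : ContDiff ℝ 2 Φ) (hU : ContDiff ℝ 2 U) (x : ℂ) :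
    lap (fun y => Φ (U y)) x = deriv Φ (U x) * lap U x +
      deriv (deriv Φ) (U x) * ((fderiv ℝ U x 1) ^ 2 + (fderiv ℝ U x I) ^ 2) := by
  have hΦ' : ContDiff ℝ 1 (deriv Φ) := by
    have : ContDiff ℝ (1 + 1) Φ := hΦ
    exact (contDiff_succ_iff_deriv.1 this).2.2
  have hd : ∀ e, (fun y => fderiv ℝ (fun y => Φ (U y)) y e) =
      fun y => deriv Φ (U y) * fderiv ℝ U y e := fun e =>
    funext fun y => fderiv_comp_real (hΦ.differentiable (by norm_num))
      (hU.differentiable (by norm_num)) y e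
  have hc : ContDiff ℝ 2 fun y => Φ (U y) := hΦ.comp hU
  rw [lap_eq, ← fderiv_fderiv_apply hc, ← fderiv_fderiv_apply hc, hd, hd,
    fderiv_mul_fderiv hΦ' hU, fderiv_mul_fderiv hΦ' hU, lap_eq]
  ring

/-- A truncation of `U` at height `δ` has Laplacian bounded in `L¹` by twice that of `U`:
`q'` controls the level-set contribution of `Φ''`. -/
lemma lintegral_lap_comp_le {U : ℂ → ℝ} (hU : ContDiff ℝ 2 U) {Φ q : ℝ → ℝ}
    (hΦ : ContDiff ℝ 2 Φ) (hq : ContDiff ℝ 1 q) {δ : ℝ}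
    (hΦ1 : ∀ s, |deriv Φ s| ≤ 1) (hq1 : ∀ s, |q s| ≤ 1)
    (hΦq : ∀ s, |deriv (deriv Φ) s| ≤ deriv q s)
    (hΦ0 : ∀ s, |s| ≤ δ → Φ s = 0) (hq0 : ∀ s, |s| ≤ δ → q s = 0)
    {K : Set ℂ} (hK : IsCompact K) (hUK : ∀ x ∉ K, |U x| ≤ δ) :
    HasCompactSupport (fun y => Φ (U y)) ∧
      ∫⁻ y, ‖lap (fun y => Φ (U y)) y‖ₑ ≤ 2 * ∫⁻ y in K, ‖lap U y‖ₑ := by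
  have hvK : ∀ x ∉ K, Φ (U x) = 0 := fun x hx => hΦ0 _ (hUK x hx)
  have hvc : HasCompactSupport (fun y => Φ (U y)) := HasCompactSupport.intro hK hvK
  refine ⟨hvc, ?_⟩
  have hvC : ContDiff ℝ 2 fun y => Φ (U y) := hΦ.comp hU
  set F : ℂ → ℂ → ℝ := fun e y => q (U y) * fderiv ℝ U y e with hF
  have hFC : ∀ e, ContDiff ℝ 1 (F e) := fun e =>
    (hq.comp (hU.of_le (by norm_num))).mul (contDiff_fderiv_apply_const hU e)
  have hFK : ∀ e, ∀ x ∉ K, F e x = 0 := fun e x hx => by simp [hF, hq0 _ (hUK x hx)]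
  have hFc : ∀ e, HasCompactSupport (F e) := fun e => HasCompactSupport.intro hK (hFK e)
  set G : ℂ → ℝ := fun x => fderiv ℝ (F 1) x 1 + fderiv ℝ (F I) x I with hG
  have h1 := integral_fderiv_eq_zero (hFC 1) (hFc 1) 1
  have hI := integral_fderiv_eq_zero (hFC I) (hFc I) I
  have hGi : Integrable G := h1.1.add hI.1
  have hG0 : ∫ x, G x = 0 := by
    rw [hG, integral_add h1.1 hI.1, h1.2, hI.2, add_zero]
  have hlc := continuous_lap hU
  have hlKi : IntegrableOn (fun y => ‖lap U y‖) K := hlc.norm.continuousOn.integrableOn_compact hK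
  have hlvc := continuous_lap hvC
  have hoff : ∀ x ∉ K, ∀ H : ℂ → ℝ, (∀ x ∉ K, H x = 0) → H =ᶠ[nhds x] fun _ => 0 :=
    fun x hx H hH => Filter.mem_of_superset (hK.isClosed.isOpen_compl.mem_nhds hx) hH
  have hlv0 : ∀ x ∉ K, lap (fun y => Φ (U y)) x = 0 := by
    intro x hx
    have h := (hoff x hx _ hvK).fderiv (𝕜 := ℝ)
    have h' := h.fderiv (𝕜 := ℝ)
    rw [lap_eq, h'.self_of_nhds]
    simp
  have hGoff : ∀ x ∉ K, G x = 0 := by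
    intro x hx
    have h1 := (hoff x hx _ (hFK 1)).fderiv_eq (𝕜 := ℝ)
    have h2 := (hoff x hx _ (hFK I)).fderiv_eq (𝕜 := ℝ)
    simp [hG, h1, h2]
  have hpt : ∀ x, ‖lap (fun y => Φ (U y)) x‖ ≤ 2 * K.indicator (fun y => ‖lap U y‖) x + G x := by
    intro x
    by_cases hx : x ∈ K
    · rw [Set.indicator_of_mem hx, lap_comp hΦ hU]
      have hGx : G x = q (U x) * lap U x +
          deriv q (U x) * ((fderiv ℝ U x 1) ^ 2 + (fderiv ℝ U x I) ^ 2) := by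
        simp only [hG, hF]
        rw [fderiv_mul_fderiv hq hU, fderiv_mul_fderiv hq hU, lap_eq]
        ring
      rw [hGx]
      set S := (fderiv ℝ U x 1) ^ 2 + (fderiv ℝ U x I) ^ 2
      have hS : 0 ≤ S := by positivity
      have a1 : ‖deriv Φ (U x) * lap U x‖ ≤ ‖lap U x‖ := by
        rw [norm_mul]
        exact mul_le_of_le_one_left (norm_nonneg _) (hΦ1 _)
      have a2 : ‖deriv (deriv Φ) (U x) * S‖ ≤ deriv q (U x) * S := by
        rw [norm_mul, Real.norm_of_nonneg hS]
        exact mul_le_mul_of_nonneg_right (hΦq _) hS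
      have a3 : ‖q (U x) * lap U x‖ ≤ ‖lap U x‖ := by
        rw [norm_mul]
        exact mul_le_of_le_one_left (norm_nonneg _) (hq1 _)
      have a4 := neg_abs_le (q (U x) * lap U x)
      rw [Real.norm_eq_abs] at a3
      have a5 := norm_add_le (deriv Φ (U x) * lap U x) (deriv (deriv Φ) (U x) * S)
      linarith
    · rw [Set.indicator_of_notMem hx, hlv0 x hx, hGoff x hx]; simp
  have hlvs : HasCompactSupport (lap fun y => Φ (U y)) := HasCompactSupport.intro hK hlv0
  have hlvi := hlvc.integrable_of_hasCompactSupport (μ := volume) hlvs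
  have hind : Integrable (K.indicator fun y => ‖lap U y‖) :=
    hlKi.integrable_indicator hK.measurableSet
  have hreal : ∫ x, ‖lap (fun y => Φ (U y)) x‖ ≤ 2 * ∫ x in K, ‖lap U x‖ := by
    refine (integral_mono hlvi.norm ((hind.const_mul 2).add hGi) hpt).trans_eq ?_
    simp only [Pi.add_apply]
    rw [integral_add (hind.const_mul 2) hGi, hG0, integral_const_mul,
      integral_indicator hK.measurableSet, add_zero]
  rw [← ofReal_integral_norm_eq_lintegral_enorm hlvi,
    ← ofReal_integral_norm_eq_lintegral_enorm (f := lap U) (μ := volume.restrict K)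
      (hlc.continuousOn.integrableOn_compact hK), ← ENNReal.ofReal_ofNat 2,
    ← ENNReal.ofReal_mul (by norm_num)]
  exact ENNReal.ofReal_le_ofReal hreal

/-- Existence of an odd smooth truncation. -/
lemma exists_truncation {δ : ℝ} (hδ : 0 < δ) :
    ∃ Φ q : ℝ → ℝ, ContDiff ℝ 2 Φ ∧ ContDiff ℝ 1 q ∧ (∀ s, |deriv Φ s| ≤ 1) ∧
      (∀ s, |q s| ≤ 1) ∧ (∀ s, |deriv (deriv Φ) s| ≤ deriv q s) ∧
      (∀ s, |s| ≤ δ → Φ s = 0) ∧ (∀ s, |s| ≤ δ → q s = 0) ∧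
      (∀ s, 2 * δ < |s| → deriv Φ s = 1) := by
  set χ : ℝ → ℝ := fun s => Real.smoothTransition ((s - δ) / δ) with hχ
  have hχC : ContDiff ℝ 2 χ :=
    Real.smoothTransition.contDiff.comp ((contDiff_id.sub contDiff_const).div_const δ)
  have hχd := hχC.differentiable (by norm_num)
  have hχ0 : ∀ s, s ≤ δ → χ s = 0 := fun s hs =>
    Real.smoothTransition.zero_of_nonpos (div_nonpos_of_nonpos_of_nonneg (by linarith) hδ.le)
  have hχ1 : ∀ s, 2 * δ < s → χ s = 1 := fun s hs =>
    Real.smoothTransition.one_of_one_le (by rw [le_div_iff₀ hδ]; linarith)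
  have hχn : ∀ s, 0 ≤ χ s := fun s => Real.smoothTransition.nonneg _
  have hχl : ∀ s, χ s ≤ 1 := fun s => Real.smoothTransition.le_one _
  have hχm : ∀ s, 0 ≤ deriv χ s := by
    have : Monotone χ := fun a b hab =>
      Real.smoothTransition.monotone (div_le_div_of_nonneg_right (by linarith) hδ.le)
    exact fun s => this.deriv_nonneg
  set p : ℝ → ℝ := fun s => χ s + χ (-s) with hp
  have hpC : ContDiff ℝ 2 p := hχC.add (hχC.comp contDiff_neg)
  have hneg : ∀ s, HasDerivAt (fun s => χ (-s)) (-deriv χ (-s)) s := fun s => by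
    have := (hχd (-s)).hasDerivAt.scomp s (hasDerivAt_neg s)
    simpa [Function.comp_def] using this
  have hΦd : ∀ s, HasDerivAt (fun s => ∫ t in (0 : ℝ)..s, p t) (p s) s := fun s =>
    intervalIntegral.integral_hasDerivAt_right (hpC.continuous.intervalIntegrable _ _)
      (hpC.continuous.stronglyMeasurableAtFilter _ _) hpC.continuous.continuousAt
  have hΦd' : deriv (fun s => ∫ t in (0 : ℝ)..s, p t) = p := funext fun s => (hΦd s).deriv
  have hdich : ∀ s, χ s = 0 ∨ χ (-s) = 0 := fun s => by
    rcases le_total s 0 with h | h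
    · exact .inl (hχ0 _ (by linarith))
    · exact .inr (hχ0 _ (by linarith))
  refine ⟨fun s => ∫ t in (0 : ℝ)..s, p t, fun s => χ s - χ (-s), ?_, ?_, ?_, ?_, ?_, ?_, ?_, ?_⟩
  · have : ContDiff ℝ (1 + 1) (fun s => ∫ t in (0 : ℝ)..s, p t) := by
      refine contDiff_succ_iff_deriv.2 ⟨fun s => (hΦd s).differentiableAt, by simp, ?_⟩
      rw [hΦd']
      exact hpC.of_le (by norm_num)
    exact this
  · exact (hχC.sub (hχC.comp contDiff_neg)).of_le (by norm_num)
  · intro s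
    rw [hΦd', abs_le]
    have a := hχn s; have b := hχn (-s); have c := hχl s; have d := hχl (-s)
    rcases hdich s with h | h <;> constructor <;> simp only [hp, h] <;> linarith
  · intro s
    rw [abs_le]
    have a := hχn s; have b := hχn (-s); have c := hχl s; have d := hχl (-s)
    constructor <;> linarith
  · intro s
    have h1 : deriv p s = deriv χ s + -deriv χ (-s) := ((hχd s).hasDerivAt.add (hneg s)).deriv
    have h2 : deriv (fun s => χ s - χ (-s)) s = deriv χ s - -deriv χ (-s) :=
      ((hχd s).hasDerivAt.sub (hneg s)).deriv
    rw [hΦd', h1, h2]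
    have a := hχm s; have b := hχm (-s)
    rw [abs_le]; constructor <;> linarith
  · intro s hs
    rw [abs_le] at hs
    have : Set.EqOn p (fun _ => 0) (Set.uIcc 0 s) := by
      intro t ht
      have h1 : -δ ≤ t ∧ t ≤ δ := by
        rcases Set.mem_uIcc.1 ht with h | h <;> constructor <;> linarith
      simp [hp, hχ0 t h1.2, hχ0 (-t) (by linarith)]
    exact (intervalIntegral.integral_congr this).trans (by simp)
  · intro s hs
    rw [abs_le] at hs
    simp [hχ0 s hs.2, hχ0 (-s) (by linarith)]
  · intro s hs
    rw [hΦd']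
    rcases lt_abs.1 hs with h | h
    · simp [hp, hχ1 s h, hχ0 (-s) (by linarith)]
    · simp [hp, hχ1 (-s) h, hχ0 s (by linarith)]

open ContinuousLinearMap in
lemma fderiv_convolution_apply {g k : ℂ → ℝ} (hg : Continuous g) (hk : ContDiff ℝ 1 k)
    (hkc : HasCompactSupport k) (x e : ℂ) :
    fderiv ℝ (fun x => ∫ t, g t * k (x - t)) x e = ∫ t, g t * fderiv ℝ k (x - t) e := by
  have h := (hkc.hasFDerivAt_convolution_right (mul ℝ ℝ) (hg.locallyIntegrable (μ := volume))
    hk x).fderiv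
  have h2 := convolution_precompR_apply (mul ℝ ℝ) (hg.locallyIntegrable (μ := volume))
    (hkc.fderiv ℝ) (hk.continuous_fderiv (by norm_num)) x e
  rw [← h] at h2
  exact h2

open ContinuousLinearMap in
lemma contDiff_convolution {g k : ℂ → ℝ} (hg : Continuous g) (hk : ContDiff ℝ 2 k)
    (hkc : HasCompactSupport k) : ContDiff ℝ 2 (fun x => ∫ t, g t * k (x - t)) :=
  hkc.contDiff_convolution_right (n := 2) (mul ℝ ℝ) (hg.locallyIntegrable (μ := volume)) hk

lemma lap_convolution {g k : ℂ → ℝ} (hg : Continuous g) (hk : ContDiff ℝ 2 k)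
    (hkc : HasCompactSupport k) (x : ℂ) :
    lap (fun x => ∫ t, g t * k (x - t)) x = ∫ t, g t * lap k (x - t) := by
  have h2 : ∀ e, fderiv ℝ (fderiv ℝ (fun x => ∫ t, g t * k (x - t))) x e e =
      ∫ t, g t * fderiv ℝ (fderiv ℝ k) (x - t) e e := by
    intro e
    rw [← fderiv_fderiv_apply (contDiff_convolution hg hk hkc)]
    have : (fun y => fderiv ℝ (fun x => ∫ t, g t * k (x - t)) y e) =
        fun y => ∫ t, g t * fderiv ℝ k (y - t) e :=
      funext fun y => fderiv_convolution_apply hg (hk.of_le (by norm_num)) hkc y e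
    rw [this, fderiv_convolution_apply hg (contDiff_fderiv_apply_const hk e)
      (hkc.fderiv_apply ℝ e)]
    simp only [fderiv_fderiv_apply hk]
  have hint : ∀ e, Integrable fun t => g t * fderiv ℝ (fderiv ℝ k) (x - t) e e := by
    intro e
    have hc : Continuous (fderiv ℝ (fderiv ℝ k)) :=
      (hk.fderiv_right (m := 1) (by norm_num)).continuous_fderiv (by norm_num)
    refine Continuous.integrable_of_hasCompactSupport (by fun_prop) ?_
    have hs : HasCompactSupport fun t => fderiv ℝ (fderiv ℝ k) (x - t) :=
      ((hkc.fderiv ℝ).fderiv ℝ).comp_homeomorph (Homeomorph.subLeft x)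
    refine hs.mono fun t ht => ?_
    contrapose! ht
    simp only [Function.mem_support, not_not] at ht ⊢
    simp [ht]
  rw [lap_eq, h2, h2, ← integral_add (hint 1) (hint I)]
  simp only [lap_eq, mul_add]

lemma lap_comp_const_sub {k : ℂ → ℝ} (hk : ContDiff ℝ 2 k) (x t : ℂ) :
    lap (fun t => k (x - t)) t = lap k (x - t) := by
  have h1 : ∀ {k : ℂ → ℝ}, ContDiff ℝ 1 k → ∀ t e,
      fderiv ℝ (fun t => k (x - t)) t e = -fderiv ℝ k (x - t) e := by
    intro k hk t e
    have := ((hk.differentiable (by norm_num) (x - t)).hasFDerivAt.comp t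
      ((hasFDerivAt_id t).const_sub x)).fderiv
    have h2 : fderiv ℝ (fun t => k (x - t)) t = _ := this
    rw [h2]; simp
  have hk' : ContDiff ℝ 2 fun t => k (x - t) := hk.comp (contDiff_const.sub contDiff_id)
  have h2 : ∀ e, fderiv ℝ (fderiv ℝ fun t => k (x - t)) t e e =
      fderiv ℝ (fderiv ℝ k) (x - t) e e := by
    intro e
    rw [← fderiv_fderiv_apply hk', ← fderiv_fderiv_apply hk]
    have : (fun y => fderiv ℝ (fun t => k (x - t)) y e) = fun y => -fderiv ℝ k (x - y) e :=
      funext fun y => h1 (hk.of_le (by norm_num)) y e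
    rw [this, fderiv_fun_neg, neg_apply, h1 (contDiff_fderiv_apply_const hk e), neg_neg]
  rw [lap_eq, lap_eq, h2, h2]

/-- A fixed smooth bump of integral one supported in the unit ball. -/
noncomputable def unitBump : ContDiffBump (0 : ℂ) := ⟨1 / 2, 1, by norm_num, by norm_num⟩

/-- The standard mollifier at scale `ε`. -/
noncomputable def mollifier (ε : ℝ) (y : ℂ) : ℝ := (ε ^ 2)⁻¹ * unitBump.normed volume (ε⁻¹ • y)

lemma contDiff_mollifier (ε : ℝ) : ContDiff ℝ (⊤ : ℕ∞) (mollifier ε) :=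
  contDiff_const.mul (unitBump.contDiff_normed.comp (contDiff_id.const_smul ε⁻¹))

lemma mollifier_nonneg (ε : ℝ) (y : ℂ) : 0 ≤ mollifier ε y :=
  mul_nonneg (by positivity) (unitBump.nonneg_normed _)

lemma tsupport_mollifier {ε : ℝ} (hε : 0 < ε) : tsupport (mollifier ε) ⊆ closedBall 0 ε := by
  refine closure_minimal (fun y hy => ?_) isClosed_closedBall
  have h : ε⁻¹ • y ∈ Function.support (unitBump.normed volume) := right_ne_zero_of_mul hy
  rw [unitBump.support_normed_eq, mem_ball_zero_iff, norm_smul, Real.norm_of_nonneg (by positivity)]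
    at h
  rw [mem_closedBall_zero_iff]
  have h' : ε⁻¹ * ‖y‖ < 1 := h
  rw [inv_mul_lt_iff₀ hε] at h'
  linarith

lemma hasCompactSupport_mollifier {ε : ℝ} (hε : 0 < ε) : HasCompactSupport (mollifier ε) :=
  (isCompact_closedBall _ _).of_isClosed_subset (isClosed_tsupport _) (tsupport_mollifier hε)

lemma integral_mollifier {ε : ℝ} (hε : 0 < ε) : ∫ y, mollifier ε y = 1 := by
  simp only [mollifier]
  rw [integral_const_mul, Measure.integral_comp_inv_smul_of_nonneg _ _ hε.le,
    unitBump.integral_normed, finrank_real_complex]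
  simp [hε.ne']

lemma integral_mollifier_sub {ε : ℝ} (hε : 0 < ε) (x : ℂ) : ∫ t, mollifier ε (x - t) = 1 := by
  rw [integral_sub_left_eq_self (fun t => mollifier ε t), integral_mollifier hε]

lemma continuous_mollifier (ε : ℝ) : Continuous (mollifier ε) := (contDiff_mollifier ε).continuous

lemma abs_mollify_sub_le {g : ℂ → ℝ} (hg : Continuous g) {ε η : ℝ} (hε : 0 < ε) (x : ℂ)
    (h : ∀ t ∈ closedBall x ε, |g t - g x| ≤ η) :
    |(∫ t, g t * mollifier ε (x - t)) - g x| ≤ η := by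
  have hs : HasCompactSupport fun t => mollifier ε (x - t) :=
    (hasCompactSupport_mollifier hε).comp_homeomorph (Homeomorph.subLeft x)
  have hc : Continuous fun t => mollifier ε (x - t) :=
    (continuous_mollifier ε).comp (continuous_const.sub continuous_id)
  have hi : Integrable fun t => mollifier ε (x - t) := hc.integrable_of_hasCompactSupport hs
  have hi2 : Integrable fun t => g t * mollifier ε (x - t) :=
    (hg.mul hc).integrable_of_hasCompactSupport hs.mul_left
  have e : (∫ t, g t * mollifier ε (x - t)) - g x = ∫ t, (g t - g x) * mollifier ε (x - t) := by
    simp only [sub_mul]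
    rw [integral_sub hi2 (hi.const_mul _), integral_const_mul, integral_mollifier_sub hε, mul_one]
  rw [e, ← Real.norm_eq_abs]
  have hη : η = ∫ t, η * mollifier ε (x - t) := by
    rw [integral_const_mul, integral_mollifier_sub hε, mul_one]
  rw [hη]
  refine norm_integral_le_of_norm_le (hi.const_mul η) (Filter.Eventually.of_forall fun t => ?_)
  rw [norm_mul, Real.norm_of_nonneg (mollifier_nonneg _ _)]
  by_cases ht : mollifier ε (x - t) = 0
  · simp [ht]
  · refine mul_le_mul_of_nonneg_right (h t ?_) (mollifier_nonneg _ _)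
    have := tsupport_mollifier hε (subset_tsupport _ ht)
    rwa [mem_closedBall_zero_iff, ← dist_eq_norm, dist_comm] at this

lemma fderiv_mollifier {ε : ℝ} (y e : ℂ) :
    fderiv ℝ (mollifier ε) y e =
      (ε ^ 2)⁻¹ * (ε⁻¹ * fderiv ℝ (unitBump.normed volume) (ε⁻¹ • y) e) := by
  have hd : Differentiable ℝ (unitBump.normed volume) :=
    (unitBump.contDiff_normed (n := 1)).differentiable (by norm_num)
  have := (((hd (ε⁻¹ • y)).hasFDerivAt.comp y
    ((hasFDerivAt_id y).const_smul ε⁻¹)).const_mul (ε ^ 2)⁻¹).fderiv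
  have h2 : fderiv ℝ (mollifier ε) y = _ := this
  rw [h2]
  simp

lemma fderiv_mollify {g : ℂ → ℝ} (hg : Continuous g) {ε : ℝ} (hε : 0 < ε) (x e : ℂ) :
    fderiv ℝ (fun x => ∫ t, g t * mollifier ε (x - t)) x e =
      ∫ z, ε⁻¹ * (g (x - ε • z) - g x) * fderiv ℝ (unitBump.normed volume) z e := by
  set ρ := unitBump.normed (volume : Measure ℂ) with hρ
  have hρC : ContDiff ℝ 1 ρ := unitBump.contDiff_normed
  have hρs : HasCompactSupport ρ := unitBump.hasCompactSupport_normed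
  have hd : Continuous fun z => fderiv ℝ ρ z e :=
    (hρC.continuous_fderiv (by norm_num)).clm_apply continuous_const
  have hds : HasCompactSupport fun z => fderiv ℝ ρ z e := hρs.fderiv_apply ℝ e
  have h0 := integral_fderiv_eq_zero hρC hρs e
  rw [fderiv_convolution_apply hg ((contDiff_mollifier ε).of_le (by norm_cast))
    (hasCompactSupport_mollifier hε)]
  have h1 : ∫ t, g t * fderiv ℝ (mollifier ε) (x - t) e =
      ∫ y, g (x - y) * fderiv ℝ (mollifier ε) y e := by
    rw [← integral_sub_left_eq_self (fun y => g (x - y) * fderiv ℝ (mollifier ε) y e) volume x]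
    simp
  have h2 : ∫ y, g (x - y) * fderiv ℝ (mollifier ε) y e =
      ∫ y, (fun z => (ε ^ 2)⁻¹ * (ε⁻¹ * g (x - ε • z) * fderiv ℝ ρ z e)) (ε⁻¹ • y) := by
    refine integral_congr_ae (Filter.Eventually.of_forall fun y => ?_)
    simp only [fderiv_mollifier, smul_smul, mul_inv_cancel₀ hε.ne', one_smul]
    ring
  rw [h1, h2, Measure.integral_comp_inv_smul_of_nonneg volume
    (fun z => (ε ^ 2)⁻¹ * (ε⁻¹ * g (x - ε • z) * fderiv ℝ ρ z e)) hε.le, finrank_real_complex,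
    integral_const_mul, smul_eq_mul, mul_inv_cancel_left₀ (by positivity)]
  have hi : Integrable fun z => ε⁻¹ * g (x - ε • z) * fderiv ℝ ρ z e := by
    refine Continuous.integrable_of_hasCompactSupport (by fun_prop) hds.mul_left
  have h3 : ∫ z, ε⁻¹ * (g (x - ε • z) - g x) * fderiv ℝ ρ z e =
      ∫ z, (ε⁻¹ * g (x - ε • z) * fderiv ℝ ρ z e - ε⁻¹ * g x * fderiv ℝ ρ z e) := by
    congr 1; ext z; ring
  rw [h3, integral_sub hi (h0.1.const_mul _), integral_const_mul, h0.2, mul_zero, sub_zero]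

open Filter Topology in
lemma tendsto_fderiv_mollify {g : ℂ → ℝ} (hg : Continuous g) {x : ℂ}
    (hgx : DifferentiableAt ℝ g x) (e : ℂ) :
    Tendsto (fun ε => fderiv ℝ (fun x => ∫ t, g t * mollifier ε (x - t)) x e) (𝓝[>] 0)
      (𝓝 (fderiv ℝ g x e)) := by
  set ρ := unitBump.normed (volume : Measure ℂ) with hρ
  have hρC : ContDiff ℝ 1 ρ := unitBump.contDiff_normed
  have hρs : HasCompactSupport ρ := unitBump.hasCompactSupport_normed
  have hd : Continuous fun z => fderiv ℝ ρ z e :=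
    (hρC.continuous_fderiv (by norm_num)).clm_apply continuous_const
  have hds : HasCompactSupport fun z => fderiv ℝ ρ z e := hρs.fderiv_apply ℝ e
  have h0 := integral_fderiv_eq_zero hρC hρs e
  set L := fderiv ℝ g x with hL
  have hlim : ∫ z, -(L z) * fderiv ℝ ρ z e = L e := by
    have hp := integral_mul_fderiv_eq_neg_fderiv_mul_of_integrable (𝕜 := ℝ)
      (μ := (volume : Measure ℂ)) (f := fun z => L z) (g := ρ) (v := e)
      (by
        refine Continuous.integrable_of_hasCompactSupport ?_ hρs.mul_left
        simp only [ContinuousLinearMap.fderiv]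
        exact continuous_const.mul hρC.continuous)
      ((L.continuous.mul hd).integrable_of_hasCompactSupport hds.mul_left)
      ((L.continuous.mul hρC.continuous).integrable_of_hasCompactSupport hρs.mul_left)
      (fun z _ => L.differentiableAt) (fun z _ => hρC.differentiable (by norm_num) z)
    simp only [neg_mul]
    rw [integral_neg, hp, neg_neg]
    simp only [ContinuousLinearMap.fderiv]
    rw [integral_const_mul, unitBump.integral_normed, mul_one]
  rw [← hlim]
  have hev : ∀ᶠ ε : ℝ in 𝓝[>] 0, fderiv ℝ (fun x => ∫ t, g t * mollifier ε (x - t)) x e =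
      ∫ z, ε⁻¹ * (g (x - ε • z) - g x) * fderiv ℝ ρ z e := by
    filter_upwards [self_mem_nhdsWithin] with ε hε
    exact fderiv_mollify hg hε x e
  refine Tendsto.congr' (EventuallyEq.symm hev) ?_
  obtain ⟨C, hC0, hC⟩ := hgx.hasFDerivAt.isBigO_sub.exists_pos
  obtain ⟨r, hr, hrC⟩ := Metric.eventually_nhds_iff.1 hC.bound
  refine tendsto_integral_filter_of_dominated_convergence (fun z => C * ‖fderiv ℝ ρ z e‖)
    (Eventually.of_forall fun ε => (by fun_prop : Continuous _).aestronglyMeasurable) ?_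
    (h0.1.norm.const_mul C) ?_
  · filter_upwards [Ioo_mem_nhdsGT hr] with ε hε
    refine Eventually.of_forall fun z => ?_
    rw [norm_mul]
    by_cases hz : z ∈ closedBall (0 : ℂ) 1
    · refine mul_le_mul_of_nonneg_right ?_ (norm_nonneg _)
      rw [mem_closedBall_zero_iff] at hz
      have hεz : ‖ε • z‖ ≤ ε := by
        rw [norm_smul, Real.norm_of_nonneg hε.1.le]
        exact mul_le_of_le_one_right hε.1.le hz
      have := @hrC (x - ε • z) (by
        rw [dist_eq_norm, sub_sub_cancel_left, norm_neg]; exact hεz.trans_lt hε.2)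
      rw [sub_sub_cancel_left, norm_neg] at this
      rw [norm_mul, norm_inv, Real.norm_of_nonneg hε.1.le, inv_mul_le_iff₀ hε.1, mul_comm ε]
      exact this.trans (mul_le_mul_of_nonneg_left hεz hC0.le)
    · have : fderiv ℝ ρ z = 0 := by
        refine image_eq_zero_of_notMem_tsupport fun h => hz ?_
        have := tsupport_fderiv_subset ℝ h
        rwa [unitBump.tsupport_normed_eq] at this
      simp [this]
  · refine Eventually.of_forall fun z => ?_
    refine Tendsto.mul_const _ ?_
    have hline : HasDerivAt (fun ε : ℝ => g (x - ε • z)) (-(L z)) 0 := by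
      have hgx' : HasFDerivAt g L (x - (0 : ℝ) • z) := by simpa using hgx.hasFDerivAt
      have := hgx'.comp_hasDerivAt (0 : ℝ)
        (((hasDerivAt_id (0 : ℝ)).smul_const z).const_sub x)
      simpa [Function.comp_def] using this
    have := (hasDerivAt_iff_tendsto_slope.1 hline).mono_left
      (nhdsWithin_mono (0 : ℝ) (fun y (hy : 0 < y) => hy.ne'))
    refine this.congr fun ε => ?_
    simp [slope_def_field, div_eq_inv_mul]

lemma lap_mollify {Ω : Set ℂ} (hΩ : MeasurableSet Ω) {f u : ℂ → ℝ}
    (hg : Continuous (Ω.indicator u))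
    (hu_eq : ∀ φ : ℂ → ℝ, ContDiff ℝ (⊤ : ℕ∞) φ → HasCompactSupport φ → tsupport φ ⊆ Ω →
      ∫ x in Ω, u x * lap φ x = ∫ x in Ω, f x * φ x)
    {ε : ℝ} (hε : 0 < ε) {x : ℂ} (hx : closedBall x ε ⊆ Ω) :
    lap (fun x => ∫ t, Ω.indicator u t * mollifier ε (x - t)) x =
      ∫ t in Ω, f t * mollifier ε (x - t) := by
  have h2 : ContDiff ℝ 2 (mollifier ε) := (contDiff_mollifier ε).of_le (by norm_cast)
  rw [lap_convolution hg h2 (hasCompactSupport_mollifier hε), ← hu_eq (fun t => mollifier ε (x - t))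
    ((contDiff_mollifier ε).comp (contDiff_const.sub contDiff_id))
    ((hasCompactSupport_mollifier hε).comp_homeomorph (Homeomorph.subLeft x)),
    ← integral_indicator hΩ]
  · congr 1
    ext t
    by_cases ht : t ∈ Ω <;> simp [ht, lap_comp_const_sub h2]
  · refine (closure_minimal (fun t ht => ?_) isClosed_closedBall).trans hx
    have := tsupport_mollifier hε (subset_tsupport _ ht)
    rwa [mem_closedBall_zero_iff, ← dist_eq_norm, dist_comm] at this

lemma lintegral_mollifier_sub {ε : ℝ} (hε : 0 < ε) (t : ℂ) :
    ∫⁻ x, ‖mollifier ε (x - t)‖ₑ = 1 := by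
  rw [lintegral_sub_right_eq_self (fun x => ‖mollifier ε x‖ₑ) t,
    ← ofReal_integral_norm_eq_lintegral_enorm
      ((continuous_mollifier ε).integrable_of_hasCompactSupport (hasCompactSupport_mollifier hε))]
  simp only [Real.norm_of_nonneg (mollifier_nonneg _ _), integral_mollifier hε, ENNReal.ofReal_one]

lemma lintegral_enorm_mollify_le {Ω K : Set ℂ} {f : ℂ → ℝ} (hf : IntegrableOn f Ω)
    {ε : ℝ} (hε : 0 < ε) :
    ∫⁻ x in K, ‖∫ t in Ω, f t * mollifier ε (x - t)‖ₑ ≤ ∫⁻ t in Ω, ‖f t‖ₑ :=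
  calc ∫⁻ x in K, ‖∫ t in Ω, f t * mollifier ε (x - t)‖ₑ
    _ ≤ ∫⁻ x, ‖∫ t in Ω, f t * mollifier ε (x - t)‖ₑ := setLIntegral_le_lintegral _ _
    _ ≤ ∫⁻ x, ∫⁻ t in Ω, ‖f t * mollifier ε (x - t)‖ₑ :=
      lintegral_mono fun x => enorm_integral_le_lintegral_enorm _
    _ = ∫⁻ t in Ω, ∫⁻ x, ‖f t * mollifier ε (x - t)‖ₑ := by
      refine lintegral_lintegral_swap (AEStronglyMeasurable.enorm ?_)
      exact hf.aestronglyMeasurable.comp_snd.mul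
        ((continuous_mollifier ε).comp (continuous_fst.sub continuous_snd)).aestronglyMeasurable
    _ = ∫⁻ t in Ω, ‖f t‖ₑ := by
      congr 1
      ext t
      simp only [enorm_mul]
      rw [lintegral_const_mul' _ _ enorm_ne_top, lintegral_mollifier_sub hε, mul_one]

open Filter Topology in
lemma const_mul_measure_rpow_le_of_eventually_mem {α : Type*} [MeasurableSpace α] {μ : Measure α}
    {E : ℕ → Set α} {S : Set α} {c C : ℝ≥0∞} (hc : c ≠ ⊤) {p : ℝ} (hp : 0 ≤ p)
    (hE : ∀ n, c * μ (E n) ^ p ≤ C) (hS : ∀ x ∈ S, ∀ᶠ n in atTop, x ∈ E n) :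
    c * μ S ^ p ≤ C := by
  set A : ℕ → Set α := fun N => ⋂ n ≥ N, E n
  have hA : Monotone A := fun M N h => Set.biInter_subset_biInter_left fun n hn => le_trans h hn
  have hSA : S ⊆ ⋃ N, A N := fun x hx => by
    obtain ⟨N, hN⟩ := eventually_atTop.1 (hS x hx)
    exact Set.mem_iUnion.2 ⟨N, Set.mem_iInter₂.2 hN⟩
  refine (show c * μ S ^ p ≤ c * μ (⋃ N, A N) ^ p by gcongr).trans ?_
  have ht : Tendsto (fun N => c * μ (A N) ^ p) atTop (𝓝 (c * μ (⋃ N, A N) ^ p)) :=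
    ENNReal.Tendsto.const_mul
      ((ENNReal.continuous_rpow_const.tendsto _).comp (tendsto_measure_iUnion_atTop hA)) (Or.inr hc)
  refine le_of_tendsto' ht fun N => le_trans ?_ (hE N)
  have : A N ⊆ E N := Set.biInter_subset_of_mem (le_refl N)
  gcongr

lemma volume_zero_set_fderiv_ne_zero {Ω : Set ℂ} (hΩ : MeasurableSet Ω) {u : ℂ → ℝ}
    (hg : Continuous (Ω.indicator u)) (hu : ∀ x ∈ Ω, DifferentiableAt ℝ u x) :
    volume {x ∈ Ω | u x = 0 ∧ fderiv ℝ u x ≠ 0} = 0 := by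
  set s : Set ℂ := Ω ∩ {x | Ω.indicator u x = 0} with hs
  have hsm : MeasurableSet s := hΩ.inter (isClosed_eq hg continuous_const).measurableSet
  have hus : ∀ x ∈ s, u x = 0 := fun x hx => by simpa [hx.1] using hx.2
  have happ : ApproximatesLinearOn (fun x => (u x : ℂ)) (0 : ℂ →L[ℝ] ℂ) s 0 := by
    intro x hx y hy
    simp [hus x hx, hus y hy]
  have := happ.norm_fderiv_sub_le volume hsm (fun x => ofRealCLM.comp (fderiv ℝ u x))
    (fun x hx => ((ofRealCLM.hasFDerivAt (x := u x)).comp x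
      (hu x hx.1).hasFDerivAt).hasFDerivWithinAt)
  rw [ae_restrict_iff' hsm] at this
  refine measure_mono_null (fun x hx => ?_) this
  intro h
  have hxs : x ∈ s := ⟨hx.1, by simp [hx.1, hx.2.1]⟩
  have h1 := h hxs
  simp only [sub_zero] at h1
  have h3 : ofRealCLM.comp (fderiv ℝ u x) = 0 := by simpa using h1
  refine hx.2.2 (ContinuousLinearMap.ext fun z => ?_)
  have h4 := congrArg (fun L : ℂ →L[ℝ] ℂ => L z) h3
  simpa using h4

open Filter Topology in
/-- The weak-type bound on the part of `Ω` where `|u|` is bounded below: mollify the extension of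
`u` by zero, truncate near zero, and pass to the limit. -/
lemma const_mul_volume_rpow_le_of_lt_abs {Ω : Set ℂ} (hΩo : IsOpen Ω) (hΩb : Bornology.IsBounded Ω)
    {f u : ℂ → ℝ} (hf : IntegrableOn f Ω) (hg : Continuous (Ω.indicator u))
    (hu_diff : ∀ x ∈ Ω, DifferentiableAt ℝ u x)
    (hu_eq : ∀ φ : ℂ → ℝ, ContDiff ℝ (⊤ : ℕ∞) φ → HasCompactSupport φ → tsupport φ ⊆ Ω →
      ∫ x in Ω, u x * lap φ x = ∫ x in Ω, f x * φ x)
    {l : ℝ} (hl : 0 < l) {δ : ℝ} (hδ : 0 < δ) :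
    ENNReal.ofReal l *
        volume {x ∈ Ω | 3 * δ < |u x| ∧ l < ‖fderiv ℝ u x‖} ^ (1 / 2 : ℝ) ≤
      ENNReal.ofReal √(2 / Real.pi) * (2 * ∫⁻ x in Ω, ‖f x‖ₑ) := by
  set g := Ω.indicator u with hg_def
  have hgu : ∀ x ∈ Ω, g x = u x := fun x hx => Set.indicator_of_mem hx u
  have hg0 : ∀ x ∉ Ω, g x = 0 := fun x hx => Set.indicator_of_notMem hx u
  have hgc : HasCompactSupport g := HasCompactSupport.intro hΩb.isCompact_closure
    fun x hx => hg0 x fun h => hx (subset_closure h)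
  set K : Set ℂ := {x | δ / 2 ≤ |g x|} with hK_def
  have hKΩ : K ⊆ Ω := fun x hx => by
    by_contra h
    have hx' : δ / 2 ≤ |g x| := hx
    rw [hg0 x h, abs_zero] at hx'
    linarith
  have hK : IsCompact K := isCompact_of_isClosed_isBounded
    (isClosed_le continuous_const hg.abs) (hΩb.subset hKΩ)
  obtain ⟨r₁, hr₁, hr₁Ω⟩ := hK.exists_cthickening_subset_open hΩo hKΩ
  obtain ⟨r₂, hr₂, hr₂g⟩ := Metric.uniformContinuous_iff.1
    (hgc.uniformContinuous_of_continuous hg) (δ / 2) (half_pos hδ)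
  set r := min r₁ (r₂ / 2) with hr_def
  have hr : 0 < r := lt_min hr₁ (half_pos hr₂)
  set ε : ℕ → ℝ := fun n => r / (n + 1) with hε_def
  have hε : ∀ n, 0 < ε n := fun n => by positivity
  have hεr : ∀ n, ε n ≤ r := fun n => div_le_self hr.le (by linarith [n.cast_nonneg (α := ℝ)])
  have hεlim : Tendsto ε atTop (𝓝[>] 0) := by
    refine tendsto_nhdsWithin_iff.2 ⟨?_, Eventually.of_forall hε⟩
    have := (tendsto_one_div_add_atTop_nhds_zero_nat (𝕜 := ℝ)).const_mul r
    simpa [hε_def, div_eq_mul_inv] using this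
  set U : ℕ → ℂ → ℝ := fun n x => ∫ t, g t * mollifier (ε n) (x - t) with hU_def
  have hUC : ∀ n, ContDiff ℝ 2 (U n) := fun n => contDiff_convolution hg
    ((contDiff_mollifier _).of_le (by norm_cast)) (hasCompactSupport_mollifier (hε n))
  have hUg : ∀ n x, |U n x - g x| ≤ δ / 2 := fun n x =>
    abs_mollify_sub_le hg (hε n) x fun t ht => by
      refine le_of_lt (hr₂g ?_)
      rw [mem_closedBall] at ht
      linarith [hεr n, min_le_right r₁ (r₂ / 2)]
  obtain ⟨Φ, q, hΦ, hq, hΦ1, hq1, hΦq, hΦ0, hq0, hΦ2⟩ := exists_truncation hδ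
  have hUK : ∀ n, ∀ x ∉ K, |U n x| ≤ δ := fun n x hx => by
    have h1 : |g x| < δ / 2 := not_le.1 hx
    linarith [hUg n x, abs_sub_abs_le_abs_sub (U n x) (g x)]
  have hlap : ∀ n, ∫⁻ x in K, ‖lap (U n) x‖ₑ ≤ ∫⁻ x in Ω, ‖f x‖ₑ := fun n => by
    rw [setLIntegral_congr_fun hK.measurableSet fun x hx => ?_]
    · exact lintegral_enorm_mollify_le hf (hε n)
    · refine congrArg _ (lap_mollify hΩo.measurableSet hg hu_eq (hε n) ?_)
      exact (closedBall_subset_closedBall ((hεr n).trans (min_le_left _ _))).trans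
        ((closedBall_subset_cthickening hx r₁).trans hr₁Ω)
  refine const_mul_measure_rpow_le_of_eventually_mem
    (E := fun n => {x | l < ‖fderiv ℝ (fun y => Φ (U n y)) x‖}) ENNReal.ofReal_ne_top
    (by norm_num) (fun n => ?_) ?_
  · obtain ⟨hc, hle⟩ := lintegral_lap_comp_le (hUC n) hΦ hq hΦ1 hq1 hΦq hΦ0 hq0 hK (hUK n)
    refine (weak_type_fderiv (hΦ.comp (hUC n)) hc hl).trans ?_
    exact mul_le_mul_right (hle.trans (mul_le_mul_right (hlap n) _)) _
  · rintro x ⟨hxΩ, hxδ, hxl⟩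
    have hgx : g =ᶠ[𝓝 x] u := by
      filter_upwards [hΩo.mem_nhds hxΩ] with y hy using hgu y hy
    have hgd : DifferentiableAt ℝ g x := (hu_diff x hxΩ).congr_of_eventuallyEq hgx
    obtain ⟨z, hz⟩ : ∃ z, l * ‖z‖ < ‖fderiv ℝ u x z‖ := by
      by_contra! h
      exact hxl.not_ge (ContinuousLinearMap.opNorm_le_bound _ hl.le h)
    have hlim := (tendsto_fderiv_mollify hg hgd z).comp hεlim
    rw [hgx.fderiv_eq] at hlim
    filter_upwards [hlim.norm.eventually (lt_mem_nhds hz)] with n hn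
    have hUx : 2 * δ < |U n x| := by
      rw [← hgu x hxΩ] at hxδ
      linarith [hUg n x, abs_sub_abs_le_abs_sub (g x) (U n x), abs_sub_comm (g x) (U n x)]
    have hd : fderiv ℝ (fun y => Φ (U n y)) x z = fderiv ℝ (U n) x z := by
      rw [fderiv_comp_real (hΦ.differentiable (by norm_num))
        ((hUC n).differentiable (by norm_num)), hΦ2 _ hUx, one_mul]
    have hn' : l * ‖z‖ < ‖fderiv ℝ (fun y => Φ (U n y)) x z‖ := by rw [hd]; exact hn
    refine lt_of_not_ge fun h => hn'.not_ge ?_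
    exact ((fderiv ℝ (fun y => Φ (U n y)) x).le_opNorm z).trans
      (mul_le_mul_of_nonneg_right h (norm_nonneg z))

/-- if `Ω ⊆ ℝ² ≅ ℂ` is a bounded open set whose boundary is a finite union of
`C¹` Jordan curves, `f ∈ L¹(Ω)` and `u` solves `Δu = f` in `Ω` (in the weak sense) with `u = 0`
on `∂Ω` (continuous extension by zero), then `∇u ∈ L^{2,∞}(Ω)` with
`‖∇u‖_{L^{2,∞}(Ω)} ≤ 3·√(2/π)·‖f‖_{L¹(Ω)}`, the constant being independent of `Ω`. -/
theorem dirichlet_gradient_weakL2_estimate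
    (Ω : Set ℂ) (hΩo : IsOpen Ω) (hΩb : Bornology.IsBounded Ω)
    (hΩbd : HasC1JordanBoundary Ω)
    (f u : ℂ → ℝ) (hf : IntegrableOn f Ω)
    (hu_cont : ContinuousOn u (closure Ω))
    (hu_diff : ∀ x ∈ Ω, DifferentiableAt ℝ u x)
    (hu_bd : ∀ x ∈ frontier Ω, u x = 0)
    (hu_eq : ∀ φ : ℂ → ℝ, ContDiff ℝ (⊤ : ℕ∞) φ → HasCompactSupport φ → tsupport φ ⊆ Ω →
      ∫ x in Ω, u x * lap φ x = ∫ x in Ω, f x * φ x) :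
    weakL2On (fun x => fderiv ℝ u x) Ω ≤
      ENNReal.ofReal (3 * Real.sqrt (2 / Real.pi)) * ENNReal.ofReal (∫ x in Ω, |f x|) := by
  have hg : Continuous (Ω.indicator u) := continuous_indicator hu_bd hu_cont
  have hnorm : ENNReal.ofReal (∫ x in Ω, |f x|) = ∫⁻ x in Ω, ‖f x‖ₑ :=
    ofReal_integral_norm_eq_lintegral_enorm hf
  refine iSup₂_le fun l hl => ?_
  have hne : ENNReal.ofReal l *
      volume {x ∈ Ω | u x ≠ 0 ∧ l < ‖fderiv ℝ u x‖} ^ (1 / 2 : ℝ) ≤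
        ENNReal.ofReal √(2 / Real.pi) * (2 * ∫⁻ x in Ω, ‖f x‖ₑ) := by
    refine const_mul_measure_rpow_le_of_eventually_mem
      (E := fun n : ℕ => {x ∈ Ω | 3 * (1 / ((n : ℝ) + 1)) < |u x| ∧ l < ‖fderiv ℝ u x‖})
      ENNReal.ofReal_ne_top (by norm_num)
      (fun n => const_mul_volume_rpow_le_of_lt_abs hΩo hΩb hf hg hu_diff hu_eq hl (by positivity))
      fun x hx => ?_
    have h0 : Filter.Tendsto (fun n : ℕ => 3 * (1 / ((n : ℝ) + 1))) Filter.atTop (nhds 0) := by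
      simpa using (tendsto_one_div_add_atTop_nhds_zero_nat (𝕜 := ℝ)).const_mul 3
    filter_upwards [h0.eventually (gt_mem_nhds (abs_pos.2 hx.2.1))] with n hn
    exact ⟨hx.1, hn, hx.2.2⟩
  have hvol : volume {x ∈ Ω | l < ‖fderiv ℝ u x‖} ≤
      volume {x ∈ Ω | u x ≠ 0 ∧ l < ‖fderiv ℝ u x‖} := by
    rw [← add_zero (volume {x ∈ Ω | u x ≠ 0 ∧ l < ‖fderiv ℝ u x‖}),
      ← volume_zero_set_fderiv_ne_zero hΩo.measurableSet hg hu_diff]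
    refine (measure_mono fun x hx => ?_).trans (measure_union_le _ _)
    by_cases h : u x = 0
    · exact Or.inr ⟨hx.1, h, norm_pos_iff.1 (hl.trans hx.2)⟩
    · exact Or.inl ⟨hx.1, h, hx.2⟩
  calc ENNReal.ofReal l * volume {x ∈ Ω | l < ‖fderiv ℝ u x‖} ^ (1 / 2 : ℝ)
    _ ≤ ENNReal.ofReal l *
        volume {x ∈ Ω | u x ≠ 0 ∧ l < ‖fderiv ℝ u x‖} ^ (1 / 2 : ℝ) := by gcongr
    _ ≤ ENNReal.ofReal √(2 / Real.pi) * (2 * ∫⁻ x in Ω, ‖f x‖ₑ) := hne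
    _ ≤ ENNReal.ofReal √(2 / Real.pi) * (3 * ∫⁻ x in Ω, ‖f x‖ₑ) := by gcongr; norm_num
    _ = _ := by
      rw [hnorm, ENNReal.ofReal_mul (by norm_num), ENNReal.ofReal_ofNat]
      ring
end

section
/- Let Ω be a bounded open subset of ℂ whose boundary is a finite union of C¹ Jordan curves, and let w : Ω̄ → ℂⁿ be continuous on the closure, continuously differentiable in Ω with ∂_{z̄} w ∈ L¹(Ω), and satisfy w = 0 on ∂Ω. Then w ∈ L^{2,∞}(Ω) with ‖w‖_{L^{2,∞}(Ω)} ≤ 3·√(2/π)·‖∂_{z̄} w‖_{L¹(Ω)}. -/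
open MeasureTheory Complex Metric
open scoped ENNReal NNReal

/-- The anti-holomorphic Wirtinger derivative `∂_{z̄} w = (1/2)(∂_{x₁} w + i ∂_{x₂} w)` of a
`ℂⁿ`-valued function on `ℂ ≅ ℝ²`, applied componentwise. -/
noncomputable def dbar {n : ℕ} (w : ℂ → EuclideanSpace ℂ (Fin n)) (x : ℂ) :
    EuclideanSpace ℂ (Fin n) :=
  (1 / 2 : ℂ) • (fderiv ℝ w x 1 + Complex.I • fderiv ℝ w x Complex.I)

/-- The part of the frontier contributed by one `C¹` Jordan curve is covered by `K` discs of
radius comparable to `1 / K`, centred on the curve. -/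
theorem IsC1JordanCurve.exists_cover {γ : Set ℂ} (hγ : IsC1JordanCurve γ) :
    ∃ C : ℝ, 0 < C ∧ ∀ K : ℕ, 0 < K → ∃ s : Finset ℂ, (↑s : Set ℂ) ⊆ γ ∧
      (∀ x ∈ γ, ∃ c ∈ s, dist x c < C / K) ∧ s.card ≤ K := by
  obtain ⟨f, hf, hper, -, -, rfl⟩ := hγ
  obtain ⟨L, hL⟩ := hf.contDiffOn.exists_lipschitzOnWith one_ne_zero
    (convex_Icc (0 : ℝ) 1) isCompact_Icc
  refine ⟨L + 1, by positivity, fun K hK ↦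
    ⟨(Finset.range K).image fun k : ℕ ↦ f (k / K), ?_, ?_, ?_⟩⟩
  · intro x hx
    simp only [Finset.coe_image, Set.mem_image] at hx
    obtain ⟨k, -, rfl⟩ := hx
    exact ⟨_, rfl⟩
  · rintro _ ⟨t, rfl⟩
    obtain ⟨u, hu, htu⟩ := hper.exists_mem_Ico₀ one_pos t
    rw [htu]
    have hK' : (0 : ℝ) < K := by exact_mod_cast hK
    have hfl : (⌊u * K⌋₊ : ℝ) ≤ u * K := Nat.floor_le (by have := hu.1; positivity)
    have hlt : u * K < ⌊u * K⌋₊ + 1 := Nat.lt_floor_add_one _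
    have hle : (⌊u * K⌋₊ : ℝ) / K ≤ u := by rwa [div_le_iff₀ hK']
    refine ⟨f ((⌊u * K⌋₊ : ℝ) / K), Finset.mem_image.2 ⟨⌊u * K⌋₊, ?_, rfl⟩, ?_⟩
    · rw [Finset.mem_range, Nat.floor_lt (by have := hu.1; positivity)]
      nlinarith [hu.2]
    · have h1 := hL.dist_le_mul u ⟨hu.1, hu.2.le⟩ ((⌊u * K⌋₊ : ℝ) / K)
        ⟨by positivity, hle.trans hu.2.le⟩
      have h2 : dist u ((⌊u * K⌋₊ : ℝ) / K) ≤ 1 / K := by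
        rw [Real.dist_eq, abs_of_nonneg (by linarith), sub_le_iff_le_add, ← add_div,
          le_div_iff₀ hK']
        linarith
      calc dist (f u) _ ≤ L * dist u ((⌊u * K⌋₊ : ℝ) / K) := h1
        _ ≤ L * (1 / K) := by gcongr
        _ < (L + 1) / K := by rw [mul_one_div]; gcongr; linarith
  · exact Finset.card_image_le.trans (by simp)

/-- A boundary made of finitely many `C¹` Jordan curves is covered by `O(K)` discs of radius
`O(1 / K)`, centred on the boundary. -/
theorem HasC1JordanBoundary.exists_cover {Ω : Set ℂ} (hΩ : HasC1JordanBoundary Ω) :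
    ∃ C : ℝ, 0 < C ∧ ∀ K : ℕ, 0 < K → ∃ s : Finset ℂ, (↑s : Set ℂ) ⊆ frontier Ω ∧
      (∀ x ∈ frontier Ω, ∃ c ∈ s, dist x c < C / K) ∧ (s.card : ℝ) ≤ C * K := by
  classical
  obtain ⟨N, γ, hγ, hfr⟩ := hΩ
  choose C hC0 hC using fun i ↦ (hγ i).exists_cover
  have hsum : 0 ≤ ∑ i, C i := Finset.sum_nonneg fun i _ ↦ (hC0 i).le
  refine ⟨∑ i, C i + N + 1, by positivity, fun K hK ↦ ?_⟩
  choose s hsγ hcov hcard using fun i ↦ hC i K hK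
  have hK' : (0 : ℝ) < K := by exact_mod_cast hK
  refine ⟨Finset.univ.biUnion s, ?_, ?_, ?_⟩
  · intro x hx
    simp only [Finset.coe_biUnion, Set.mem_iUnion] at hx
    obtain ⟨i, -, hx⟩ := hx
    exact hfr ▸ Set.mem_iUnion.2 ⟨i, hsγ i hx⟩
  · intro x hx
    rw [hfr] at hx
    obtain ⟨i, hi⟩ := Set.mem_iUnion.1 hx
    obtain ⟨c, hc, hd⟩ := hcov i x hi
    refine ⟨c, Finset.mem_biUnion.2 ⟨i, Finset.mem_univ i, hc⟩, hd.trans_le ?_⟩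
    have := Finset.single_le_sum (fun j _ ↦ (hC0 j).le) (Finset.mem_univ i)
    gcongr
    have hN : (0 : ℝ) ≤ N := by positivity
    linarith
  · have h1 : (Finset.univ.biUnion s).card ≤ N * K :=
      Finset.card_biUnion_le.trans
        ((Finset.sum_le_card_nsmul _ _ K fun i _ ↦ hcard i).trans (by simp))
    calc ((Finset.univ.biUnion s).card : ℝ) ≤ N * K := by exact_mod_cast h1
      _ ≤ _ := by gcongr; linarith

theorem lintegral_enorm_inv_ball_le (R : ℝ) (hR : 0 ≤ R) :
    ∫⁻ z in ball (0 : ℂ) R, ‖z⁻¹‖ₑ ≤ ENNReal.ofReal (2 * Real.pi * R) := by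
  rw [← lintegral_indicator measurableSet_ball, ← Complex.lintegral_comp_polarCoord_symm]
  calc _ ≤ ∫⁻ p in _root_.polarCoord.target,
        (Set.Ioo (0 : ℝ) R ×ˢ Set.Ioo (-Real.pi) Real.pi).indicator 1 p := by
        refine setLIntegral_mono' _root_.polarCoord.open_target.measurableSet fun p hp ↦ ?_
        rw [_root_.polarCoord_target] at hp
        have hp0 : 0 < p.1 := hp.1
        by_cases h : Complex.polarCoord.symm p ∈ ball (0 : ℂ) R
        · have hpR : p.1 < R := by
            rwa [mem_ball_zero_iff, Complex.norm_polarCoord_symm, abs_of_pos hp0] at h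
          rw [Set.indicator_of_mem h, Set.indicator_of_mem (Set.mem_prod.2 ⟨Set.mem_Ioo.2 ⟨hp0, hpR⟩, hp.2⟩),
            ← ofReal_norm, norm_inv, Complex.norm_polarCoord_symm, abs_of_pos hp0,
            smul_eq_mul, ← ENNReal.ofReal_mul hp0.le, mul_inv_cancel₀ hp0.ne']
          simp
        · rw [Set.indicator_of_notMem h, smul_zero]
          exact zero_le
    _ ≤ ∫⁻ p, (Set.Ioo (0 : ℝ) R ×ˢ Set.Ioo (-Real.pi) Real.pi).indicator 1 p :=
        setLIntegral_le_lintegral _ _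
    _ = ENNReal.ofReal (2 * Real.pi * R) := by
        rw [lintegral_indicator_one (measurableSet_Ioo.prod measurableSet_Ioo),
          Measure.volume_eq_prod, Measure.prod_prod, Real.volume_Ioo, Real.volume_Ioo,
          ← ENNReal.ofReal_mul (by linarith)]
        congr 1; ring

/-- Bathtub-type bound for the kernel `1 / |z - ζ|` on a set of given measure. -/
theorem setLIntegral_enorm_inv_sub_le (S : Set ℂ) (ζ : ℂ) {R : ℝ} (hR : 0 < R) :
    ∫⁻ z in S, ‖(ζ - z)⁻¹‖ₑ ≤
      ENNReal.ofReal (2 * Real.pi * R) + ENNReal.ofReal R⁻¹ * volume S := by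
  calc ∫⁻ z in S, ‖(ζ - z)⁻¹‖ₑ
      ≤ ∫⁻ z in S, ((ball ζ R).indicator (fun z ↦ ‖(ζ - z)⁻¹‖ₑ) z + ENNReal.ofReal R⁻¹) := by
        refine lintegral_mono fun z ↦ ?_
        by_cases h : z ∈ ball ζ R
        · simp [Set.indicator_of_mem h]
        · rw [Set.indicator_of_notMem h, zero_add, ← ofReal_norm, norm_inv]
          rw [mem_ball', not_lt, dist_eq_norm] at h
          gcongr
    _ = (∫⁻ z in S, (ball ζ R).indicator (fun z ↦ ‖(ζ - z)⁻¹‖ₑ) z)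
          + ENNReal.ofReal R⁻¹ * volume S := by
        rw [lintegral_add_right _ measurable_const, setLIntegral_const]
    _ ≤ _ := by
        gcongr
        refine (setLIntegral_le_lintegral _ _).trans ?_
        rw [← lintegral_sub_left_eq_self _ ζ]
        refine le_trans (le_of_eq ?_) (lintegral_enorm_inv_ball_le R hR.le)
        rw [← lintegral_indicator measurableSet_ball]
        refine lintegral_congr fun z ↦ ?_
        simp [Set.indicator, mem_ball, dist_eq_norm]

open Complex in
theorem dbar_polar {n : ℕ} (w : ℂ → EuclideanSpace ℂ (Fin n)) (x : ℂ) (θ : ℝ) :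
    fderiv ℝ w x (exp (θ * I)) + I • fderiv ℝ w x (I * exp (θ * I)) =
      (2 * exp (-(θ * I))) • dbar w x := by
  have h1 : exp (θ * I) = Real.cos θ • (1 : ℂ) + Real.sin θ • I := by
    rw [exp_mul_I]; simp
  have h2 : I * exp (θ * I) = (-Real.sin θ) • (1 : ℂ) + Real.cos θ • I := by
    rw [h1]; simp only [real_smul]; push_cast; linear_combination sin (θ : ℂ) * I_mul_I
  have h3 : exp (-(θ * I)) = Real.cos θ - Real.sin θ * I := by
    rw [← neg_mul, exp_mul_I]; simp [sub_eq_add_neg]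
  rw [h2, h1, h3, dbar]
  simp only [map_add, map_smul]
  ext i
  simp
  ring_nf
  simp

open Complex in
/-- The norm inequality contained in the Cauchy–Pompeiu formula at the origin. -/
theorem enorm_apply_zero_le_lintegral_dbar {n : ℕ} {w : ℂ → EuclideanSpace ℂ (Fin n)}
    (hw : ContDiff ℝ 1 w) (hc : HasCompactSupport w) :
    ENNReal.ofReal Real.pi * ‖w 0‖ₑ ≤ ∫⁻ z, ‖z⁻¹‖ₑ * ‖dbar w z‖ₑ := by
  set T : Set (ℝ × ℝ) := Set.Ioi (0 : ℝ) ×ˢ Set.Ioo (-Real.pi) Real.pi with hT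
  have hTm : MeasurableSet T := measurableSet_Ioi.prod measurableSet_Ioo
  set e : ℝ → ℂ := fun θ ↦ exp (θ * I) with he
  have hecont : Continuous e := by fun_prop
  have hnorm : ∀ θ, ‖e θ‖ = 1 := fun θ ↦ norm_exp_ofReal_mul_I θ
  have hdcont : Continuous (fderiv ℝ w) := hw.continuous_fderiv one_ne_zero
  set G₁ : ℝ × ℝ → EuclideanSpace ℂ (Fin n) :=
    fun p ↦ fderiv ℝ w (p.1 * e p.2) (e p.2) with hG₁
  set G₂ : ℝ × ℝ → EuclideanSpace ℂ (Fin n) :=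
    fun p ↦ I • fderiv ℝ w (p.1 * e p.2) (I * e p.2) with hG₂
  have hG₁c : Continuous G₁ := by
    have : Continuous fun p : ℝ × ℝ ↦ fderiv ℝ w (p.1 * e p.2) := hdcont.comp (by fun_prop)
    exact this.clm_apply (by fun_prop)
  have hG₂c : Continuous G₂ := by
    have : Continuous fun p : ℝ × ℝ ↦ fderiv ℝ w (p.1 * e p.2) := hdcont.comp (by fun_prop)
    exact (this.clm_apply (by fun_prop)).const_smul I
  obtain ⟨R, hR⟩ := hc.isCompact.isBounded.subset_closedBall (0 : ℂ)
  have hzero : ∀ z : ℂ, R < ‖z‖ → fderiv ℝ w z = 0 := by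
    intro z hz
    refine image_eq_zero_of_notMem_tsupport fun h ↦ ?_
    have := hR (tsupport_fderiv_subset ℝ h)
    rw [mem_closedBall_zero_iff] at this
    linarith
  have hint : ∀ G : ℝ × ℝ → EuclideanSpace ℂ (Fin n), Continuous G →
      (∀ p, fderiv ℝ w (p.1 * e p.2) = 0 → G p = 0) → IntegrableOn G T := by
    intro G hG h0
    have hK : IntegrableOn G (Set.Icc 0 R ×ˢ Set.Icc (-Real.pi) Real.pi) :=
      hG.continuousOn.integrableOn_compact (isCompact_Icc.prod isCompact_Icc)
    refine hK.of_forall_sdiff_eq_zero hTm fun p hp ↦ h0 p (hzero _ ?_)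
    obtain ⟨⟨h1, h2⟩, h3⟩ := hp
    have h1 : 0 < p.1 := h1
    rw [norm_mul, hnorm, mul_one, norm_real, Real.norm_of_nonneg h1.le]
    by_contra! h
    exact h3 ⟨⟨h1.le, h⟩, h2.1.le, h2.2.le⟩
  have hi₁ : IntegrableOn G₁ T := hint G₁ hG₁c fun p hp ↦ by simp [hG₁, hp]
  have hi₂ : IntegrableOn G₂ T := hint G₂ hG₂c fun p hp ↦ by simp [hG₂, hp]
  have hI₁ : ∫ p in T, G₁ p = -((2 * Real.pi : ℝ) • w 0) := by
    rw [Measure.volume_eq_prod] at hi₁ ⊢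
    rw [hT, ← setIntegral_prod_swap, setIntegral_prod]
    · have : ∀ θ : ℝ, ∫ r in Set.Ioi (0 : ℝ), G₁ (r, θ) = - w 0 := by
        intro θ
        have hd : ∀ r : ℝ, HasDerivAt (fun r : ℝ ↦ w (r * e θ)) (G₁ (r, θ)) r := by
          intro r
          have h1 : HasDerivAt (fun r : ℝ ↦ (r : ℂ) * e θ) (e θ) r := by
            simpa using (ofRealCLM.hasDerivAt (x := r)).mul_const (e θ)
          exact ((hw.differentiable one_ne_zero _).hasFDerivAt).comp_hasDerivAt r h1
        have hcs : HasCompactSupport fun r : ℝ ↦ w (r * e θ) := by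
          refine HasCompactSupport.of_support_subset_isCompact (isCompact_Icc (a := -R) (b := R))
            fun r hr ↦ ?_
          have := hR (subset_tsupport _ hr)
          rw [mem_closedBall_zero_iff, norm_mul, hnorm, mul_one, norm_real] at this
          exact abs_le.1 this
        have := hcs.integral_Ioi_deriv_eq
          (hw.comp (ofRealCLM.contDiff.mul contDiff_const)) 0
        refine Eq.trans (integral_congr_ae (.of_forall fun r ↦ (hd r).deriv.symm)) (this.trans ?_)
        simp
      simp only [Prod.swap_prod_mk, this, setIntegral_const]
      rw [Measure.real, Real.volume_Ioo, ENNReal.toReal_ofReal (by linarith [Real.pi_pos])]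
      simp [two_mul]
    · exact hi₁.swap
  have hI₂ : ∫ p in T, G₂ p = 0 := by
    rw [Measure.volume_eq_prod] at hi₂ ⊢
    rw [hT, setIntegral_prod _ hi₂]
    refine setIntegral_eq_zero_of_forall_eq_zero fun r hr ↦ ?_
    have hr : 0 < r := hr
    have hd : ∀ θ : ℝ, HasDerivAt (fun θ : ℝ ↦ (r⁻¹ : ℝ) • I • w (r * e θ)) (G₂ (r, θ)) θ := by
      intro θ
      have h0 : HasDerivAt e (exp (θ * I) * (1 * I)) θ :=
        ((ofRealCLM.hasDerivAt (x := θ)).mul_const I).cexp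
      have h1 : HasDerivAt (fun θ : ℝ ↦ (r : ℂ) * e θ) (r • (I * e θ)) θ := by
        refine (h0.const_mul (r : ℂ)).congr_deriv ?_
        simp [he, mul_comm]
      have h2 := ((((hw.differentiable one_ne_zero _).hasFDerivAt).comp_hasDerivAt θ
        h1).const_smul I).const_smul r⁻¹
      refine h2.congr_deriv ?_
      rw [map_smul, smul_comm I r, smul_smul, inv_mul_cancel₀ hr.ne', one_smul]
    have hcont : Continuous fun θ : ℝ ↦ G₂ (r, θ) := by fun_prop
    rw [← integral_Ioc_eq_integral_Ioo,
      ← intervalIntegral.integral_of_le (by linarith [Real.pi_pos]),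
      intervalIntegral.integral_eq_sub_of_hasDerivAt (fun θ _ ↦ hd θ)
        (hcont.intervalIntegrable _ _)]
    have : e Real.pi = e (-Real.pi) := by
      simp [he, exp_neg]
    rw [this, sub_self]
  have hI : ∫ p in T, (G₁ p + G₂ p) = -((2 * Real.pi : ℝ) • w 0) := by
    rw [integral_add hi₁ hi₂, hI₁, hI₂, add_zero]
  have hG : ∀ p : ℝ × ℝ, ‖G₁ p + G₂ p‖ₑ = 2 * ‖dbar w (p.1 * e p.2)‖ₑ := by
    intro p
    simp only [hG₁, hG₂, he]
    rw [dbar_polar, enorm_smul, enorm_mul, ← neg_mul, ← ofReal_neg,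
      ← ofReal_norm (exp _), norm_exp_ofReal_mul_I]
    rw [← ofReal_norm (2 : ℂ)]
    simp
  have key : 2 * (ENNReal.ofReal Real.pi * ‖w 0‖ₑ) ≤
      2 * ∫⁻ p in T, ‖dbar w (p.1 * e p.2)‖ₑ := by
    calc 2 * (ENNReal.ofReal Real.pi * ‖w 0‖ₑ) = ‖∫ p in T, (G₁ p + G₂ p)‖ₑ := by
          rw [hI, enorm_neg, enorm_smul, ← mul_assoc, Real.enorm_eq_ofReal (by positivity),
            ENNReal.ofReal_mul (by norm_num)]
          simp
      _ ≤ ∫⁻ p in T, ‖G₁ p + G₂ p‖ₑ := enorm_integral_le_lintegral_enorm _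
      _ = _ := by
          simp only [hG]
          rw [lintegral_const_mul' _ _ (by simp)]
  rw [ENNReal.mul_le_mul_iff_right (by simp) (by simp)] at key
  refine key.trans (le_of_eq ?_)
  rw [← Complex.lintegral_comp_polarCoord_symm, _root_.polarCoord_target]
  refine setLIntegral_congr_fun hTm fun p hp ↦ ?_
  have hp0 : 0 < p.1 := hp.1
  have hpe : Complex.polarCoord.symm p = p.1 * e p.2 := by
    rw [Complex.polarCoord_symm_apply, he]; simp [exp_mul_I]
  simp only [hpe, smul_eq_mul]
  rw [← mul_assoc, ← ofReal_norm (_)⁻¹, norm_inv, norm_mul, hnorm, mul_one, norm_real,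
    Real.norm_of_nonneg hp0.le, ← ENNReal.ofReal_mul hp0.le, mul_inv_cancel₀ hp0.ne']
  simp

theorem dbar_comp_add_right {n : ℕ} (w : ℂ → EuclideanSpace ℂ (Fin n)) (a x : ℂ) :
    dbar (fun z ↦ w (z + a)) x = dbar w (x + a) := by
  simp only [dbar, fderiv_comp_add_right]

/-- The norm inequality contained in the Cauchy–Pompeiu formula. -/
theorem enorm_apply_le_lintegral_dbar {n : ℕ} {w : ℂ → EuclideanSpace ℂ (Fin n)}
    (hw : ContDiff ℝ 1 w) (hc : HasCompactSupport w) (a : ℂ) :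
    ENNReal.ofReal Real.pi * ‖w a‖ₑ ≤ ∫⁻ z, ‖(z - a)⁻¹‖ₑ * ‖dbar w z‖ₑ := by
  have h := enorm_apply_zero_le_lintegral_dbar (w := fun z ↦ w (z + a))
    (hw.comp (by fun_prop)) (hc.comp_homeomorph (Homeomorph.addRight a))
  rw [zero_add] at h
  refine h.trans (le_of_eq ?_)
  rw [← lintegral_add_right_eq_self (fun z ↦ ‖(z - a)⁻¹‖ₑ * ‖dbar w z‖ₑ) a]
  simp [dbar_comp_add_right]

/-- Smooth cut-off functions vanishing on given discs of radius `δ`, equal to `1` away from the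
concentric discs of radius `2 * δ`, with the natural gradient bound. -/
theorem exists_cutoff_discs :
    ∃ L : ℝ, 0 ≤ L ∧ ∀ δ : ℝ, 0 < δ → ∀ s : Finset ℂ, ∃ χ : ℂ → ℝ, ContDiff ℝ 1 χ ∧
      (∀ x, 0 ≤ χ x ∧ χ x ≤ 1) ∧ (∀ c ∈ s, ∀ x, dist x c ≤ δ → χ x = 0) ∧
      (∀ x, (∀ c ∈ s, 2 * δ ≤ dist x c) → χ x = 1) ∧
      ∀ x, ‖fderiv ℝ χ x‖ ≤ ∑ c ∈ s, (closedBall c (2 * δ)).indicator (fun _ ↦ L / δ) x := by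
  classical
  let b : ContDiffBump (0 : ℂ) := ⟨1, 2, one_pos, one_lt_two⟩
  have hb : ContDiff ℝ 1 b := b.contDiff
  obtain ⟨L, hL⟩ := (b.hasCompactSupport.fderiv ℝ).exists_bound_of_continuous
    (hb.continuous_fderiv one_ne_zero)
  have hL0 : 0 ≤ L := (norm_nonneg _).trans (hL 0)
  refine ⟨L, hL0, fun δ hδ s ↦ ?_⟩
  have hnorm : ∀ x c : ℂ, ‖δ⁻¹ • (x - c)‖ = dist x c / δ := fun x c ↦ by
    rw [norm_smul, norm_inv, Real.norm_of_nonneg hδ.le, dist_eq_norm, div_eq_inv_mul]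
  induction s using Finset.induction_on with
  | empty => exact ⟨fun _ ↦ 1, contDiff_const, by simp, by simp, by simp, by simp⟩
  | insert c s hc ih =>
    obtain ⟨χ, hχ, hχ01, hχ0, hχ1, hχd⟩ := ih
    set ψ : ℂ → ℝ := fun x ↦ b (δ⁻¹ • (x - c)) with hψ
    have hψc : ContDiff ℝ 1 ψ := hb.comp (by fun_prop)
    have hψ01 : ∀ x, 0 ≤ ψ x ∧ ψ x ≤ 1 := fun x ↦ ⟨b.nonneg, b.le_one⟩
    have hψd : ∀ x, ‖fderiv ℝ ψ x‖ ≤ (closedBall c (2 * δ)).indicator (fun _ ↦ L / δ) x := by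
      intro x
      have h1 : HasFDerivAt (fun x : ℂ ↦ δ⁻¹ • (x - c)) (δ⁻¹ • ContinuousLinearMap.id ℝ ℂ) x :=
        ((hasFDerivAt_id x).sub_const c).const_smul δ⁻¹
      have h2 : HasFDerivAt ψ _ x := HasFDerivAt.comp (g := b) x
        (hb.differentiable one_ne_zero (δ⁻¹ • (x - c))).hasFDerivAt h1
      rw [h2.fderiv]
      by_cases h : x ∈ closedBall c (2 * δ)
      · rw [Set.indicator_of_mem h, ContinuousLinearMap.comp_smul, ContinuousLinearMap.comp_id,
          norm_smul, norm_inv, Real.norm_of_nonneg hδ.le, div_eq_inv_mul]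
        gcongr
        exact hL _
      · have h3 : fderiv ℝ b (δ⁻¹ • (x - c)) = 0 := by
          refine image_eq_zero_of_notMem_tsupport fun h' ↦ h ?_
          have := tsupport_fderiv_subset ℝ h'
          rw [b.tsupport_eq, mem_closedBall_zero_iff, hnorm, div_le_iff₀ hδ] at this
          exact this
        rw [h3]
        simp [Set.indicator_of_notMem h]
    refine ⟨fun x ↦ χ x * (1 - ψ x), hχ.mul (contDiff_const.sub hψc), fun x ↦ ?_, ?_, ?_, ?_⟩
    · have h1 := hχ01 x
      have h2 := hψ01 x
      exact ⟨mul_nonneg h1.1 (by linarith), mul_le_one₀ h1.2 (by linarith) (by linarith)⟩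
    · intro c' hc' x hx
      rcases Finset.mem_insert.1 hc' with rfl | h
      · have : ψ x = 1 := b.one_of_mem_closedBall (by
          rw [mem_closedBall_zero_iff, hnorm, div_le_iff₀ hδ]
          exact hx.trans_eq (one_mul δ).symm)
        simp [this]
      · simp [hχ0 c' h x hx]
    · intro x hx
      have : ψ x = 0 := b.zero_of_le_dist (by
        rw [dist_zero_right, hnorm, le_div_iff₀ hδ]
        exact hx c (Finset.mem_insert_self c s))
      simp [this, hχ1 x fun c' h ↦ hx c' (Finset.mem_insert_of_mem h)]
    · intro x
      have h1 := (hχ.differentiable one_ne_zero x).hasFDerivAt.mul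
        ((hψc.differentiable one_ne_zero x).hasFDerivAt.const_sub 1)
      rw [Finset.sum_insert hc]
      have h2 : fderiv ℝ (fun x ↦ χ x * (1 - ψ x)) x = _ := h1.fderiv
      rw [h2]
      refine (norm_add_le _ _).trans (add_le_add ?_ ?_)
      · rw [norm_smul, norm_neg, Real.norm_of_nonneg (hχ01 x).1]
        exact (mul_le_of_le_one_left (norm_nonneg _) (hχ01 x).2).trans (hψd x)
      · have h3 := hψ01 x
        rw [norm_smul, Real.norm_of_nonneg (by linarith)]
        exact (mul_le_of_le_one_left (norm_nonneg _) (by linarith)).trans (hχd x)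

theorem norm_dbar_smul_le {n : ℕ} {χ : ℂ → ℝ} {w : ℂ → EuclideanSpace ℂ (Fin n)} {x : ℂ}
    (hχ : DifferentiableAt ℝ χ x) (hw : DifferentiableAt ℝ w x) (h0 : 0 ≤ χ x) (h1 : χ x ≤ 1) :
    ‖dbar (fun z ↦ χ z • w z) x‖ ≤ ‖dbar w x‖ + ‖w x‖ * ‖fderiv ℝ χ x‖ := by
  have h : dbar (fun z ↦ χ z • w z) x = χ x • dbar w x +
      (1 / 2 : ℂ) • (fderiv ℝ χ x 1 • w x + I • fderiv ℝ χ x I • w x) := by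
    rw [dbar, dbar, fderiv_fun_smul hχ hw]
    ext i
    simp
    ring
  have hd : ∀ v : ℂ, ‖v‖ = 1 → ‖fderiv ℝ χ x v • w x‖ ≤ ‖w x‖ * ‖fderiv ℝ χ x‖ := by
    intro v hv
    rw [norm_smul, mul_comm]
    gcongr
    simpa [hv] using (fderiv ℝ χ x).le_opNorm v
  rw [h]
  refine (norm_add_le _ _).trans (add_le_add ?_ ?_)
  · rw [norm_smul, Real.norm_of_nonneg h0]
    exact mul_le_of_le_one_left (norm_nonneg _) h1
  · have h2 := norm_add_le (fderiv ℝ χ x 1 • w x) (I • fderiv ℝ χ x I • w x)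
    have h3 := hd 1 norm_one
    have h4 := hd I norm_I
    rw [norm_smul I, norm_I, one_mul] at h2
    rw [norm_smul]
    norm_num
    linarith

/-- The norm inequality contained in the Cauchy–Pompeiu formula, for functions vanishing on the
boundary of a domain with `C¹` boundary; no control of the full gradient is needed. -/
theorem enorm_apply_le_setLIntegral_dbar {n : ℕ} {Ω : Set ℂ} (hΩo : IsOpen Ω)
    (hΩb : Bornology.IsBounded Ω) (hΩbd : HasC1JordanBoundary Ω)
    {w : ℂ → EuclideanSpace ℂ (Fin n)} (hw_cont : ContinuousOn w (closure Ω))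
    (hw_diff : ContDiffOn ℝ 1 w Ω) (hw_bd : ∀ x ∈ frontier Ω, w x = 0) {a : ℂ} (ha : a ∈ Ω) :
    ENNReal.ofReal Real.pi * ‖w a‖ₑ ≤ ∫⁻ z in Ω, ‖(z - a)⁻¹‖ₑ * ‖dbar w z‖ₑ := by
  obtain ⟨C, hC, hcover⟩ := hΩbd.exists_cover
  obtain ⟨L, hL, hcutoff⟩ := exists_cutoff_discs
  obtain ⟨d, hd, hda⟩ := Metric.isOpen_iff.1 hΩo a ha
  have hfr : ∀ x ∈ frontier Ω, x ∉ Ω := fun x hx hxΩ ↦ by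
    rw [hΩo.frontier_eq] at hx
    exact hx.2 hxΩ
  have hda' : ∀ c ∈ frontier Ω, d ≤ dist a c := fun c hc ↦ by
    by_contra! h
    exact hfr c hc (hda (mem_ball'.2 h))
  refine ENNReal.le_of_forall_pos_le_add fun ε hε _ ↦ ?_
  set D : ℝ := 8 * Real.pi * L * C ^ 2 / d with hD
  have hD0 : 0 ≤ D := by positivity
  set η : ℝ := ε / (D + 1) with hη
  have hη0 : 0 < η := by positivity
  have hcompact : IsCompact (closure Ω) := hΩb.isCompact_closure
  obtain ⟨ρ, hρ, hρw⟩ := Metric.uniformContinuousOn_iff.1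
    (hcompact.uniformContinuousOn_of_continuous hw_cont) η hη0
  obtain ⟨K, hK⟩ := exists_nat_gt (2 * C / min ρ (d / 2))
  have hm : 0 < min ρ (d / 2) := lt_min hρ (by linarith)
  have hK0 : (0 : ℝ) < K := lt_of_le_of_lt (by positivity) hK
  obtain ⟨s, hsfr, hscov, hscard⟩ := hcover K (by exact_mod_cast hK0)
  set δ : ℝ := C / K with hδ
  have hδ0 : 0 < δ := by positivity
  have hδm : 2 * δ < min ρ (d / 2) := by
    rw [div_lt_iff₀ hm] at hK
    rw [hδ, ← mul_div_assoc, div_lt_iff₀ hK0]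
    linarith
  have hδρ : 2 * δ < ρ := hδm.trans_le (min_le_left _ _)
  have hδd : 2 * δ < d / 2 := hδm.trans_le (min_le_right _ _)
  have hcardδ : s.card * δ ≤ C ^ 2 := by
    calc s.card * δ ≤ C * K * (C / K) := by rw [hδ]; gcongr
      _ = C ^ 2 := by field_simp
  obtain ⟨χ, hχ, hχ01, hχ0, hχ1, hχd⟩ := hcutoff δ hδ0 s
  set W : ℂ → EuclideanSpace ℂ (Fin n) := Ω.indicator fun z ↦ χ z • w z with hW
  have hWin : ∀ x ∈ Ω, W =ᶠ[nhds x] fun z ↦ χ z • w z := fun x hx ↦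
    (hΩo.eventually_mem hx).mono fun y hy ↦ Set.indicator_of_mem hy _
  have hWout : ∀ x ∉ Ω, W =ᶠ[nhds x] fun _ ↦ 0 := by
    intro x hx
    by_cases hxc : x ∈ closure Ω
    · have hxf : x ∈ frontier Ω := by rw [hΩo.frontier_eq]; exact ⟨hxc, hx⟩
      obtain ⟨c, hc, hxc⟩ := hscov x hxf
      refine (isOpen_ball.eventually_mem (mem_ball.2 hxc)).mono fun y hy ↦ ?_
      simp [hW, Set.indicator, hχ0 c hc y (mem_ball.1 hy).le]
    · refine (isClosed_closure.isOpen_compl.eventually_mem hxc).mono fun y hy ↦ ?_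
      exact Set.indicator_of_notMem (fun h ↦ hy (subset_closure h)) _
  have hwdiff : ∀ x ∈ Ω, ContDiffAt ℝ 1 w x := fun x hx ↦
    hw_diff.contDiffAt (hΩo.mem_nhds hx)
  have hWdiff : ContDiff ℝ 1 W := by
    refine contDiff_iff_contDiffAt.2 fun x ↦ ?_
    by_cases hx : x ∈ Ω
    · exact (hχ.contDiffAt.smul (hwdiff x hx)).congr_of_eventuallyEq (hWin x hx)
    · exact contDiffAt_const.congr_of_eventuallyEq (hWout x hx)
  have hWc : HasCompactSupport W :=
    HasCompactSupport.of_support_subset_isCompact hcompact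
      (Set.support_indicator_subset.trans subset_closure)
  have hWa : W a = w a := by
    rw [hW, Set.indicator_of_mem ha, hχ1 a fun c hc ↦ ?_, one_smul]
    linarith [hda' c (hsfr hc)]
  set κ : ℝ := 2 / d * η * (L / δ) with hκ
  have hκ0 : 0 ≤ κ := by positivity
  have hpt : ∀ z, ‖(z - a)⁻¹‖ₑ * ‖dbar W z‖ₑ ≤
      Ω.indicator (fun z ↦ ‖(z - a)⁻¹‖ₑ * ‖dbar w z‖ₑ) z +
        ∑ c ∈ s, (closedBall c (2 * δ)).indicator (fun _ ↦ ENNReal.ofReal κ) z := by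
    intro z
    by_cases hz : z ∈ Ω
    · have h1 : dbar W z = dbar (fun z ↦ χ z • w z) z := by
        rw [dbar, dbar, (hWin z hz).fderiv_eq]
      have h2 := norm_dbar_smul_le (hχ.differentiable one_ne_zero z)
        ((hwdiff z hz).differentiableAt one_ne_zero) (hχ01 z).1 (hχ01 z).2
      have h3 : ‖(z - a)⁻¹‖ * (‖w z‖ * ‖fderiv ℝ χ z‖) ≤
          ∑ c ∈ s, (closedBall c (2 * δ)).indicator (fun _ ↦ κ) z := by
        calc _ ≤ ‖(z - a)⁻¹‖ * (‖w z‖ *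
              ∑ c ∈ s, (closedBall c (2 * δ)).indicator (fun _ ↦ L / δ) z) := by
              gcongr
              exact hχd z
          _ = ∑ c ∈ s, ‖(z - a)⁻¹‖ * ‖w z‖ *
              (closedBall c (2 * δ)).indicator (fun _ ↦ L / δ) z := by
              rw [← mul_assoc, Finset.mul_sum]
          _ ≤ _ := by
              refine Finset.sum_le_sum fun c hc ↦ ?_
              by_cases hzc : z ∈ closedBall c (2 * δ)
              · rw [Set.indicator_of_mem hzc, Set.indicator_of_mem hzc, hκ]
                have hzc' : dist z c ≤ 2 * δ := hzc
                have hcf := hsfr hc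
                have hwz : ‖w z‖ ≤ η := by
                  have := hρw z (subset_closure hz) c (frontier_subset_closure hcf)
                    (hzc'.trans_lt hδρ)
                  rw [hw_bd c hcf, dist_zero_right] at this
                  exact this.le
                have hza : d / 2 ≤ ‖z - a‖ := by
                  have h4 := dist_triangle a z c
                  have h5 := hda' c hcf
                  rw [← dist_eq_norm, dist_comm]
                  linarith
                have hinv : ‖(z - a)⁻¹‖ ≤ 2 / d := by
                  rw [norm_inv, ← inv_div]
                  gcongr
                gcongr
              · rw [Set.indicator_of_notMem hzc, Set.indicator_of_notMem hzc, mul_zero]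
      rw [Set.indicator_of_mem hz, h1]
      have h4 : ∑ c ∈ s, (closedBall c (2 * δ)).indicator (fun _ ↦ ENNReal.ofReal κ) z =
          ENNReal.ofReal (∑ c ∈ s, (closedBall c (2 * δ)).indicator (fun _ ↦ κ) z) := by
        rw [ENNReal.ofReal_sum_of_nonneg fun c _ ↦ Set.indicator_nonneg (fun _ _ ↦ hκ0) z]
        refine Finset.sum_congr rfl fun c _ ↦ ?_
        by_cases hzc : z ∈ closedBall c (2 * δ)
        · rw [Set.indicator_of_mem hzc, Set.indicator_of_mem hzc]
        · rw [Set.indicator_of_notMem hzc, Set.indicator_of_notMem hzc, ENNReal.ofReal_zero]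
      rw [h4]
      simp only [← ofReal_norm]
      rw [← ENNReal.ofReal_mul (norm_nonneg _), ← ENNReal.ofReal_mul (norm_nonneg _),
        ← ENNReal.ofReal_add (by positivity) (le_trans (by positivity) h3)]
      refine ENNReal.ofReal_le_ofReal ?_
      calc _ ≤ ‖(z - a)⁻¹‖ * (‖dbar w z‖ + ‖w z‖ * ‖fderiv ℝ χ z‖) := by gcongr
        _ ≤ _ := by rw [mul_add]; gcongr
    · have h1 : dbar W z = 0 := by
        rw [dbar, (hWout z hz).fderiv_eq]
        simp
      rw [h1, enorm_zero, mul_zero]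
      exact zero_le
  rw [← hWa]
  refine (enorm_apply_le_lintegral_dbar hWdiff hWc a).trans ((lintegral_mono hpt).trans ?_)
  rw [lintegral_add_right _ (Finset.measurable_fun_sum _ fun c _ ↦
      measurable_const.indicator measurableSet_closedBall),
    lintegral_indicator hΩo.measurableSet,
    lintegral_finsetSum _ fun c _ ↦ measurable_const.indicator measurableSet_closedBall]
  gcongr
  have hball : ∀ c : ℂ, ∫⁻ z, (closedBall c (2 * δ)).indicator (fun _ ↦ ENNReal.ofReal κ) z =
      ENNReal.ofReal (κ * ((2 * δ) ^ 2 * Real.pi)) := by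
    intro c
    rw [lintegral_indicator measurableSet_closedBall, setLIntegral_const,
      Complex.volume_closedBall, ENNReal.ofReal_mul (q := (2 * δ) ^ 2 * Real.pi) hκ0,
      ENNReal.ofReal_mul (p := (2 * δ) ^ 2) (by positivity), ENNReal.ofReal_pow (by positivity), ← NNReal.coe_real_pi, ENNReal.ofReal_coe_nnreal]
  simp only [hball, Finset.sum_const, nsmul_eq_mul]
  rw [← ENNReal.ofReal_natCast, ← ENNReal.ofReal_mul (by positivity), ← ENNReal.ofReal_coe_nnreal]
  refine ENNReal.ofReal_le_ofReal ?_
  calc (s.card : ℝ) * (κ * ((2 * δ) ^ 2 * Real.pi))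
      = (s.card * δ) * (8 * Real.pi * L / d * η) := by rw [hκ]; field_simp; ring
    _ ≤ C ^ 2 * (8 * Real.pi * L / d * η) := by gcongr
    _ = D * η := by rw [hD]; ring
    _ ≤ (D + 1) * η := by gcongr; linarith
    _ = ε := by rw [hη]; field_simp

/-- if `Ω ⊆ ℂ` is a bounded open set whose boundary is a finite union of `C¹`
Jordan curves and `w : Ω̄ → ℂⁿ` is continuous on the closure, `C¹` in `Ω` with
`∂_{z̄} w ∈ L¹(Ω)`, and `w = 0` on `∂Ω`, then `w ∈ L^{2,∞}(Ω)` with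
`‖w‖_{L^{2,∞}(Ω)} ≤ 3·√(2/π)·‖∂_{z̄} w‖_{L¹(Ω)}`. -/
theorem weakL2_estimate_dbar
    (n : ℕ) (Ω : Set ℂ) (hΩo : IsOpen Ω) (hΩb : Bornology.IsBounded Ω)
    (hΩbd : HasC1JordanBoundary Ω)
    (w : ℂ → EuclideanSpace ℂ (Fin n))
    (hw_cont : ContinuousOn w (closure Ω))
    (hw_diff : ContDiffOn ℝ 1 w Ω)
    (hw_int : IntegrableOn (dbar w) Ω)
    (hw_bd : ∀ x ∈ frontier Ω, w x = 0) :
    weakL2On w Ω ≤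
      ENNReal.ofReal (3 * Real.sqrt (2 / Real.pi)) *
        ENNReal.ofReal (∫ x in Ω, ‖dbar w x‖) := by
  refine iSup₂_le fun l hl ↦ ?_
  set S : Set ℂ := {x ∈ Ω | l < ‖w x‖} with hS
  have hSo : IsOpen S :=
    (hw_cont.mono subset_closure).norm.isOpen_inter_preimage hΩo isOpen_Ioi
  set F : ℝ := ∫ x in Ω, ‖dbar w x‖ with hF
  have hF0 : 0 ≤ F := integral_nonneg fun _ ↦ norm_nonneg _
  have hFl : ∫⁻ x in Ω, ‖dbar w x‖ₑ = ENNReal.ofReal F :=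
    (ofReal_integral_norm_eq_lintegral_enorm hw_int).symm
  have hSfin : volume S ≠ ⊤ := (hΩb.subset fun x hx ↦ hx.1).measure_lt_top.ne
  have key : ∀ R : ℝ, 0 < R → ENNReal.ofReal (Real.pi * l) * volume S ≤
      ENNReal.ofReal F * (ENNReal.ofReal (2 * Real.pi * R) + ENNReal.ofReal R⁻¹ * volume S) := by
    intro R hR
    calc ENNReal.ofReal (Real.pi * l) * volume S
        = ∫⁻ _ in S, ENNReal.ofReal (Real.pi * l) := (setLIntegral_const _ _).symm
      _ ≤ ∫⁻ z in S, ∫⁻ ζ in Ω, ‖(ζ - z)⁻¹‖ₑ * ‖dbar w ζ‖ₑ := by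
          refine setLIntegral_mono' hSo.measurableSet fun z hz ↦ ?_
          refine le_trans ?_ (enorm_apply_le_setLIntegral_dbar hΩo hΩb hΩbd hw_cont hw_diff
            hw_bd hz.1)
          rw [ENNReal.ofReal_mul Real.pi_pos.le, ← ofReal_norm]
          gcongr
          exact hz.2.le
      _ = ∫⁻ ζ in Ω, ∫⁻ z in S, ‖(ζ - z)⁻¹‖ₑ * ‖dbar w ζ‖ₑ := by
          refine lintegral_lintegral_swap ?_
          refine AEMeasurable.mul (f := fun p : ℂ × ℂ ↦ ‖(p.2 - p.1)⁻¹‖ₑ)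
            (g := fun p : ℂ × ℂ ↦ ‖dbar w p.2‖ₑ) ?_ ?_
          · exact (by fun_prop : Measurable fun p : ℂ × ℂ ↦ ‖(p.2 - p.1)⁻¹‖ₑ).aemeasurable
          · exact hw_int.aestronglyMeasurable.enorm.comp_snd
      _ = ∫⁻ ζ in Ω, (∫⁻ z in S, ‖(ζ - z)⁻¹‖ₑ) * ‖dbar w ζ‖ₑ := by
          refine lintegral_congr fun ζ ↦ lintegral_mul_const _ (by fun_prop)
      _ ≤ ∫⁻ ζ in Ω, (ENNReal.ofReal (2 * Real.pi * R) + ENNReal.ofReal R⁻¹ * volume S) *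
            ‖dbar w ζ‖ₑ := by
          gcongr with ζ
          exact setLIntegral_enorm_inv_sub_le S ζ hR
      _ = _ := by
          rw [lintegral_const_mul' _ _ (by finiteness), hFl, mul_comm]
  set m : ℝ := (volume S).toReal with hm
  have hSm : volume S = ENNReal.ofReal m := (ENNReal.ofReal_toReal hSfin).symm
  have hm0 : 0 ≤ m := ENNReal.toReal_nonneg
  have hreal : l * √m ≤ 3 * √(2 / Real.pi) * F := by
    rcases hm0.eq_or_lt with h | h
    · rw [← h, Real.sqrt_zero, mul_zero]; positivity
    have hpi := Real.pi_pos
    set R : ℝ := √(m / (2 * Real.pi)) with hR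
    have hR0 : 0 < R := Real.sqrt_pos.2 (by positivity)
    have hmR : m = 2 * Real.pi * R ^ 2 := by
      rw [hR, Real.sq_sqrt (by positivity)]; field_simp
    have h1 := key R hR0
    rw [hSm, ← ENNReal.ofReal_mul (by positivity), ← ENNReal.ofReal_mul (by positivity),
      ← ENNReal.ofReal_add (by positivity) (by positivity), ← ENNReal.ofReal_mul hF0,
      ENNReal.ofReal_le_ofReal_iff (by positivity)] at h1
    have h2 : Real.pi * l * m = (2 * Real.pi * R) * (Real.pi * l * R) := by rw [hmR]; ring
    have h3 : F * (2 * Real.pi * R + R⁻¹ * m) = (2 * Real.pi * R) * (2 * F) := by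
      rw [hmR]; field_simp; ring
    rw [h2, h3] at h1
    have h4 : Real.pi * l * R ≤ 2 * F := le_of_mul_le_mul_left h1 (by positivity)
    have h5 : √m = √(2 / Real.pi) * (Real.pi * R) := by
      rw [hmR, Real.sqrt_eq_iff_mul_self_eq (by positivity) (by positivity), mul_mul_mul_comm,
        Real.mul_self_sqrt (by positivity)]
      field_simp
    rw [h5]
    have h6 : 0 ≤ √(2 / Real.pi) := Real.sqrt_nonneg _
    nlinarith [mul_le_mul_of_nonneg_left h4 h6, mul_nonneg h6 hF0]
  rw [hSm, ENNReal.ofReal_rpow_of_nonneg hm0 (by norm_num), ← Real.sqrt_eq_rpow,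
    ← ENNReal.ofReal_mul hl.le, ← ENNReal.ofReal_mul (by positivity)]
  exact ENNReal.ofReal_le_ofReal hreal
end
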